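/- Let (B₁, B₂, μ_l, ν_l, μ_r, ν_r) be a Hopf datum, π := (η₁ ∘ ε₁) ⊗ id_{B₂ ⊗ B₁} ⊗ (η₂ ∘ ε₂) the idempotent on B₁ ⊗ B₂ ⊗ B₁ ⊗ B₂, and Φ the recursion operator on End(B₁ ⊗ B₂ ⊗ B₁ ⊗ B₂) of Definition 2.10. Then for every endomorphism f of B₁ ⊗ B₂ ⊗ B₁ ⊗ B₂, π ∘ Φ(f) ∘ π = π ∘ f ∘ π. -/

import Mathlib

open TensorProduct
open scoped TensorProduct

set_option maxHeartbeats 1000000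
set_option linter.unusedVariables false

namespace CPB

section Combinators
variable {k : Type*} [CommRing k]
variable {A B C D R R' : Type*}
  [AddCommMonoid A] [Module k A] [AddCommMonoid B] [Module k B]
  [AddCommMonoid C] [Module k C] [AddCommMonoid D] [Module k D]
  [AddCommMonoid R] [Module k R] [AddCommMonoid R'] [Module k R']

/-- apply a map to the tail of a right-nested tensor product -/
noncomputable def skp (g : R →ₗ[k] R') : (A ⊗[k] R) →ₗ[k] (A ⊗[k] R') :=
  TensorProduct.map LinearMap.id g

/-- apply a two-strand operation to the first two strands -/
noncomputable def pair2 (op : (A ⊗[k] B) →ₗ[k] (C ⊗[k] D)) :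
    (A ⊗[k] (B ⊗[k] R)) →ₗ[k] (C ⊗[k] (D ⊗[k] R)) :=
  (TensorProduct.assoc k C D R).toLinearMap ∘ₗ
    TensorProduct.map op LinearMap.id ∘ₗ (TensorProduct.assoc k A B R).symm.toLinearMap

/-- multiply the first two strands together -/
noncomputable def merge2 (m : (A ⊗[k] B) →ₗ[k] C) :
    (A ⊗[k] (B ⊗[k] R)) →ₗ[k] (C ⊗[k] R) :=
  TensorProduct.map m LinearMap.id ∘ₗ (TensorProduct.assoc k A B R).symm.toLinearMap

/-- split the first strand in two -/
noncomputable def split2 (d : A →ₗ[k] (C ⊗[k] D)) :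
    (A ⊗[k] R) →ₗ[k] (C ⊗[k] (D ⊗[k] R)) :=
  (TensorProduct.assoc k C D R).toLinearMap ∘ₗ TensorProduct.map d LinearMap.id

/-- transpose the first two strands -/
noncomputable def swap2 : (A ⊗[k] (B ⊗[k] R)) →ₗ[k] (B ⊗[k] (A ⊗[k] R)) :=
  pair2 (TensorProduct.comm k A B).toLinearMap

/-- pair the two first strands off into a scalar -/
noncomputable def payL (p : (A ⊗[k] B) →ₗ[k] k) :
    (A ⊗[k] (B ⊗[k] R)) →ₗ[k] R :=
  (TensorProduct.lid k R).toLinearMap ∘ₗ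
    TensorProduct.map p LinearMap.id ∘ₗ (TensorProduct.assoc k A B R).symm.toLinearMap

end Combinators

section Apply4
variable {k : Type*} [CommRing k] {B1 B2 R : Type*}
  [AddCommMonoid B1] [Module k B1] [AddCommMonoid B2] [Module k B2]
  [AddCommMonoid R] [Module k R]

/-- apply an endomorphism of the four-fold tensor product to the first four strands -/
noncomputable def apply4
    (f : (B1 ⊗[k] (B2 ⊗[k] (B1 ⊗[k] B2))) →ₗ[k] (B1 ⊗[k] (B2 ⊗[k] (B1 ⊗[k] B2)))) :
    (B1 ⊗[k] (B2 ⊗[k] (B1 ⊗[k] (B2 ⊗[k] R)))) →ₗ[k]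
      (B1 ⊗[k] (B2 ⊗[k] (B1 ⊗[k] (B2 ⊗[k] R)))) :=
  letI E : ((B1 ⊗[k] (B2 ⊗[k] (B1 ⊗[k] B2))) ⊗[k] R) ≃ₗ[k]
      (B1 ⊗[k] (B2 ⊗[k] (B1 ⊗[k] (B2 ⊗[k] R)))) :=
    (TensorProduct.assoc k B1 (B2 ⊗[k] (B1 ⊗[k] B2)) R) ≪≫ₗ
      TensorProduct.congr (LinearEquiv.refl k B1)
        ((TensorProduct.assoc k B2 (B1 ⊗[k] B2) R) ≪≫ₗ
          TensorProduct.congr (LinearEquiv.refl k B2) (TensorProduct.assoc k B1 B2 R))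
  E.toLinearMap ∘ₗ TensorProduct.map f LinearMap.id ∘ₗ E.symm.toLinearMap

end Apply4

section Structures
variable (k : Type*) [CommRing k] (M : Type*) [AddCommMonoid M] [Module k M]

/-- `(M, mul, unit)` is an associative unital algebra (in terms of linear maps). -/
structure IsAlgMaps (mul : (M ⊗[k] M) →ₗ[k] M) (unit : k →ₗ[k] M) : Prop where
  mul_assoc :
    mul ∘ₗ TensorProduct.map mul LinearMap.id =
      mul ∘ₗ TensorProduct.map LinearMap.id mul ∘ₗ (TensorProduct.assoc k M M M).toLinearMap
  one_mul :
    mul ∘ₗ TensorProduct.map unit LinearMap.id ∘ₗ (TensorProduct.lid k M).symm.toLinearMap =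
      LinearMap.id
  mul_one :
    mul ∘ₗ TensorProduct.map LinearMap.id unit ∘ₗ (TensorProduct.rid k M).symm.toLinearMap =
      LinearMap.id

/-- `(M, comul, counit)` is a coassociative counital coalgebra (in terms of linear maps). -/
structure IsCoalgMaps (comul : M →ₗ[k] (M ⊗[k] M)) (counit : M →ₗ[k] k) : Prop where
  coassoc :
    (TensorProduct.assoc k M M M).toLinearMap ∘ₗ TensorProduct.map comul LinearMap.id ∘ₗ comul =
      TensorProduct.map LinearMap.id comul ∘ₗ comul
  counit_left :
    (TensorProduct.lid k M).toLinearMap ∘ₗ TensorProduct.map counit LinearMap.id ∘ₗ comul =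
      LinearMap.id
  counit_right :
    (TensorProduct.rid k M).toLinearMap ∘ₗ TensorProduct.map LinearMap.id counit ∘ₗ comul =
      LinearMap.id

/-- the given structure maps make `M` a bialgebra. -/
structure IsBialgebraMaps (mul : (M ⊗[k] M) →ₗ[k] M) (unit : k →ₗ[k] M)
    (comul : M →ₗ[k] (M ⊗[k] M)) (counit : M →ₗ[k] k) : Prop where
  alg : IsAlgMaps k M mul unit
  coalg : IsCoalgMaps k M comul counit
  comul_mul :
    comul ∘ₗ mul =
      TensorProduct.map mul mul ∘ₗ (TensorProduct.tensorTensorTensorComm k M M M M).toLinearMap ∘ₗ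
        TensorProduct.map comul comul
  counit_mul :
    counit ∘ₗ mul = LinearMap.mul' k k ∘ₗ TensorProduct.map counit counit
  comul_unit :
    comul ∘ₗ unit = TensorProduct.map unit unit ∘ₗ (TensorProduct.lid k k).symm.toLinearMap
  counit_unit : counit ∘ₗ unit = LinearMap.id

/-- an object which is simultaneously an algebra and a coalgebra. -/
structure ACData where
  mul : (M ⊗[k] M) →ₗ[k] M
  unit : k →ₗ[k] M
  comul : M →ₗ[k] (M ⊗[k] M)
  counit : M →ₗ[k] k
  alg : IsAlgMaps k M mul unit
  coalg : IsCoalgMaps k M comul counit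

end Structures

section Cross
variable {k : Type*} [CommRing k] {B1 B2 : Type*}
  [AddCommMonoid B1] [Module k B1] [AddCommMonoid B2] [Module k B2]

/-- the multiplication `(m₁ ⊗ m₂) ∘ (id ⊗ φ₂₁ ⊗ id)` of a would-be cross product bialgebra -/
noncomputable def crossMul (m1 : (B1 ⊗[k] B1) →ₗ[k] B1) (m2 : (B2 ⊗[k] B2) →ₗ[k] B2)
    (phi21 : (B2 ⊗[k] B1) →ₗ[k] (B1 ⊗[k] B2)) :
    ((B1 ⊗[k] B2) ⊗[k] (B1 ⊗[k] B2)) →ₗ[k] (B1 ⊗[k] B2) :=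
  ((skp m2) : (B1 ⊗[k] (B2 ⊗[k] B2)) →ₗ[k] (B1 ⊗[k] B2))
    ∘ₗ ((merge2 m1) : (B1 ⊗[k] (B1 ⊗[k] (B2 ⊗[k] B2))) →ₗ[k] (B1 ⊗[k] (B2 ⊗[k] B2)))
    ∘ₗ ((skp (pair2 phi21)) : (B1 ⊗[k] (B2 ⊗[k] (B1 ⊗[k] B2))) →ₗ[k]
        (B1 ⊗[k] (B1 ⊗[k] (B2 ⊗[k] B2))))
    ∘ₗ (TensorProduct.assoc k B1 B2 (B1 ⊗[k] B2)).toLinearMap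

/-- the unit `η₁ ⊗ η₂` of a would-be cross product bialgebra -/
noncomputable def crossUnit (eta1 : k →ₗ[k] B1) (eta2 : k →ₗ[k] B2) :
    k →ₗ[k] (B1 ⊗[k] B2) :=
  TensorProduct.map eta1 eta2 ∘ₗ (TensorProduct.lid k k).symm.toLinearMap

/-- the comultiplication `(id ⊗ φ₁₂ ⊗ id) ∘ (Δ₁ ⊗ Δ₂)` of a would-be cross product bialgebra -/
noncomputable def crossComul (delta1 : B1 →ₗ[k] (B1 ⊗[k] B1)) (delta2 : B2 →ₗ[k] (B2 ⊗[k] B2))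
    (phi12 : (B1 ⊗[k] B2) →ₗ[k] (B2 ⊗[k] B1)) :
    (B1 ⊗[k] B2) →ₗ[k] ((B1 ⊗[k] B2) ⊗[k] (B1 ⊗[k] B2)) :=
  (TensorProduct.assoc k B1 B2 (B1 ⊗[k] B2)).symm.toLinearMap
    ∘ₗ ((skp (pair2 phi12)) : (B1 ⊗[k] (B1 ⊗[k] (B2 ⊗[k] B2))) →ₗ[k]
        (B1 ⊗[k] (B2 ⊗[k] (B1 ⊗[k] B2))))
    ∘ₗ ((skp (skp delta2)) : (B1 ⊗[k] (B1 ⊗[k] B2)) →ₗ[k] (B1 ⊗[k] (B1 ⊗[k] (B2 ⊗[k] B2))))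
    ∘ₗ ((split2 delta1) : (B1 ⊗[k] B2) →ₗ[k] (B1 ⊗[k] (B1 ⊗[k] B2)))

/-- the counit `ε₁ ⊗ ε₂` of a would-be cross product bialgebra -/
noncomputable def crossCounit (eps1 : B1 →ₗ[k] k) (eps2 : B2 →ₗ[k] k) :
    (B1 ⊗[k] B2) →ₗ[k] k :=
  LinearMap.mul' k k ∘ₗ TensorProduct.map eps1 eps2

end Cross


section HopfDatumSection
variable (k : Type*) [CommRing k] (B1 B2 : Type*)
  [AddCommMonoid B1] [Module k B1] [AddCommMonoid B2] [Module k B2]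

noncomputable def ax_actL_act (m1 : (B1 ⊗[k] B1) →ₗ[k] B1) (eta1 : k →ₗ[k] B1)
    (delta1 : B1 →ₗ[k] (B1 ⊗[k] B1)) (eps1 : B1 →ₗ[k] k)
    (m2 : (B2 ⊗[k] B2) →ₗ[k] B2) (eta2 : k →ₗ[k] B2)
    (delta2 : B2 →ₗ[k] (B2 ⊗[k] B2)) (eps2 : B2 →ₗ[k] k)
    (actL : (B2 ⊗[k] B1) →ₗ[k] B1) (coactL : B1 →ₗ[k] (B2 ⊗[k] B1))
    (actR : (B2 ⊗[k] B1) →ₗ[k] B2) (coactR : B2 →ₗ[k] (B2 ⊗[k] B1)) : Prop :=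
    actL ∘ₗ ((merge2 m2) : (B2 ⊗[k] (B2 ⊗[k] B1)) →ₗ[k] (B2 ⊗[k] B1)) =
      actL ∘ₗ ((skp actL) : (B2 ⊗[k] (B2 ⊗[k] B1)) →ₗ[k] (B2 ⊗[k] B1))

noncomputable def ax_actL_unit (m1 : (B1 ⊗[k] B1) →ₗ[k] B1) (eta1 : k →ₗ[k] B1)
    (delta1 : B1 →ₗ[k] (B1 ⊗[k] B1)) (eps1 : B1 →ₗ[k] k)
    (m2 : (B2 ⊗[k] B2) →ₗ[k] B2) (eta2 : k →ₗ[k] B2)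
    (delta2 : B2 →ₗ[k] (B2 ⊗[k] B2)) (eps2 : B2 →ₗ[k] k)
    (actL : (B2 ⊗[k] B1) →ₗ[k] B1) (coactL : B1 →ₗ[k] (B2 ⊗[k] B1))
    (actR : (B2 ⊗[k] B1) →ₗ[k] B2) (coactR : B2 →ₗ[k] (B2 ⊗[k] B1)) : Prop :=
    actL ∘ₗ TensorProduct.map eta2 LinearMap.id ∘ₗ (TensorProduct.lid k B1).symm.toLinearMap =
      LinearMap.id

noncomputable def ax_actR_act (m1 : (B1 ⊗[k] B1) →ₗ[k] B1) (eta1 : k →ₗ[k] B1)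
    (delta1 : B1 →ₗ[k] (B1 ⊗[k] B1)) (eps1 : B1 →ₗ[k] k)
    (m2 : (B2 ⊗[k] B2) →ₗ[k] B2) (eta2 : k →ₗ[k] B2)
    (delta2 : B2 →ₗ[k] (B2 ⊗[k] B2)) (eps2 : B2 →ₗ[k] k)
    (actL : (B2 ⊗[k] B1) →ₗ[k] B1) (coactL : B1 →ₗ[k] (B2 ⊗[k] B1))
    (actR : (B2 ⊗[k] B1) →ₗ[k] B2) (coactR : B2 →ₗ[k] (B2 ⊗[k] B1)) : Prop :=
    actR ∘ₗ ((skp m1) : (B2 ⊗[k] (B1 ⊗[k] B1)) →ₗ[k] (B2 ⊗[k] B1)) =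
      actR ∘ₗ ((merge2 actR) : (B2 ⊗[k] (B1 ⊗[k] B1)) →ₗ[k] (B2 ⊗[k] B1))

noncomputable def ax_actR_unit (m1 : (B1 ⊗[k] B1) →ₗ[k] B1) (eta1 : k →ₗ[k] B1)
    (delta1 : B1 →ₗ[k] (B1 ⊗[k] B1)) (eps1 : B1 →ₗ[k] k)
    (m2 : (B2 ⊗[k] B2) →ₗ[k] B2) (eta2 : k →ₗ[k] B2)
    (delta2 : B2 →ₗ[k] (B2 ⊗[k] B2)) (eps2 : B2 →ₗ[k] k)
    (actL : (B2 ⊗[k] B1) →ₗ[k] B1) (coactL : B1 →ₗ[k] (B2 ⊗[k] B1))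
    (actR : (B2 ⊗[k] B1) →ₗ[k] B2) (coactR : B2 →ₗ[k] (B2 ⊗[k] B1)) : Prop :=
    actR ∘ₗ TensorProduct.map LinearMap.id eta1 ∘ₗ (TensorProduct.rid k B2).symm.toLinearMap =
      LinearMap.id

noncomputable def ax_coactL_coact (m1 : (B1 ⊗[k] B1) →ₗ[k] B1) (eta1 : k →ₗ[k] B1)
    (delta1 : B1 →ₗ[k] (B1 ⊗[k] B1)) (eps1 : B1 →ₗ[k] k)
    (m2 : (B2 ⊗[k] B2) →ₗ[k] B2) (eta2 : k →ₗ[k] B2)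
    (delta2 : B2 →ₗ[k] (B2 ⊗[k] B2)) (eps2 : B2 →ₗ[k] k)
    (actL : (B2 ⊗[k] B1) →ₗ[k] B1) (coactL : B1 →ₗ[k] (B2 ⊗[k] B1))
    (actR : (B2 ⊗[k] B1) →ₗ[k] B2) (coactR : B2 →ₗ[k] (B2 ⊗[k] B1)) : Prop :=
    ((split2 delta2) : (B2 ⊗[k] B1) →ₗ[k] (B2 ⊗[k] (B2 ⊗[k] B1))) ∘ₗ coactL =
      ((skp coactL) : (B2 ⊗[k] B1) →ₗ[k] (B2 ⊗[k] (B2 ⊗[k] B1))) ∘ₗ coactL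

noncomputable def ax_coactL_counit (m1 : (B1 ⊗[k] B1) →ₗ[k] B1) (eta1 : k →ₗ[k] B1)
    (delta1 : B1 →ₗ[k] (B1 ⊗[k] B1)) (eps1 : B1 →ₗ[k] k)
    (m2 : (B2 ⊗[k] B2) →ₗ[k] B2) (eta2 : k →ₗ[k] B2)
    (delta2 : B2 →ₗ[k] (B2 ⊗[k] B2)) (eps2 : B2 →ₗ[k] k)
    (actL : (B2 ⊗[k] B1) →ₗ[k] B1) (coactL : B1 →ₗ[k] (B2 ⊗[k] B1))
    (actR : (B2 ⊗[k] B1) →ₗ[k] B2) (coactR : B2 →ₗ[k] (B2 ⊗[k] B1)) : Prop :=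
    (TensorProduct.lid k B1).toLinearMap ∘ₗ TensorProduct.map eps2 LinearMap.id ∘ₗ coactL =
      LinearMap.id

noncomputable def ax_coactR_coact (m1 : (B1 ⊗[k] B1) →ₗ[k] B1) (eta1 : k →ₗ[k] B1)
    (delta1 : B1 →ₗ[k] (B1 ⊗[k] B1)) (eps1 : B1 →ₗ[k] k)
    (m2 : (B2 ⊗[k] B2) →ₗ[k] B2) (eta2 : k →ₗ[k] B2)
    (delta2 : B2 →ₗ[k] (B2 ⊗[k] B2)) (eps2 : B2 →ₗ[k] k)
    (actL : (B2 ⊗[k] B1) →ₗ[k] B1) (coactL : B1 →ₗ[k] (B2 ⊗[k] B1))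
    (actR : (B2 ⊗[k] B1) →ₗ[k] B2) (coactR : B2 →ₗ[k] (B2 ⊗[k] B1)) : Prop :=
    ((split2 coactR) : (B2 ⊗[k] B1) →ₗ[k] (B2 ⊗[k] (B1 ⊗[k] B1))) ∘ₗ coactR =
      ((skp delta1) : (B2 ⊗[k] B1) →ₗ[k] (B2 ⊗[k] (B1 ⊗[k] B1))) ∘ₗ coactR

noncomputable def ax_coactR_counit (m1 : (B1 ⊗[k] B1) →ₗ[k] B1) (eta1 : k →ₗ[k] B1)
    (delta1 : B1 →ₗ[k] (B1 ⊗[k] B1)) (eps1 : B1 →ₗ[k] k)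
    (m2 : (B2 ⊗[k] B2) →ₗ[k] B2) (eta2 : k →ₗ[k] B2)
    (delta2 : B2 →ₗ[k] (B2 ⊗[k] B2)) (eps2 : B2 →ₗ[k] k)
    (actL : (B2 ⊗[k] B1) →ₗ[k] B1) (coactL : B1 →ₗ[k] (B2 ⊗[k] B1))
    (actR : (B2 ⊗[k] B1) →ₗ[k] B2) (coactR : B2 →ₗ[k] (B2 ⊗[k] B1)) : Prop :=
    (TensorProduct.rid k B2).toLinearMap ∘ₗ TensorProduct.map LinearMap.id eps1 ∘ₗ coactR =
      LinearMap.id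

noncomputable def ax_actR_eta2 (m1 : (B1 ⊗[k] B1) →ₗ[k] B1) (eta1 : k →ₗ[k] B1)
    (delta1 : B1 →ₗ[k] (B1 ⊗[k] B1)) (eps1 : B1 →ₗ[k] k)
    (m2 : (B2 ⊗[k] B2) →ₗ[k] B2) (eta2 : k →ₗ[k] B2)
    (delta2 : B2 →ₗ[k] (B2 ⊗[k] B2)) (eps2 : B2 →ₗ[k] k)
    (actL : (B2 ⊗[k] B1) →ₗ[k] B1) (coactL : B1 →ₗ[k] (B2 ⊗[k] B1))
    (actR : (B2 ⊗[k] B1) →ₗ[k] B2) (coactR : B2 →ₗ[k] (B2 ⊗[k] B1)) : Prop :=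
    actR ∘ₗ TensorProduct.map eta2 LinearMap.id ∘ₗ (TensorProduct.lid k B1).symm.toLinearMap =
      eta2 ∘ₗ eps1

noncomputable def ax_coactL_eps1 (m1 : (B1 ⊗[k] B1) →ₗ[k] B1) (eta1 : k →ₗ[k] B1)
    (delta1 : B1 →ₗ[k] (B1 ⊗[k] B1)) (eps1 : B1 →ₗ[k] k)
    (m2 : (B2 ⊗[k] B2) →ₗ[k] B2) (eta2 : k →ₗ[k] B2)
    (delta2 : B2 →ₗ[k] (B2 ⊗[k] B2)) (eps2 : B2 →ₗ[k] k)
    (actL : (B2 ⊗[k] B1) →ₗ[k] B1) (coactL : B1 →ₗ[k] (B2 ⊗[k] B1))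
    (actR : (B2 ⊗[k] B1) →ₗ[k] B2) (coactR : B2 →ₗ[k] (B2 ⊗[k] B1)) : Prop :=
    (TensorProduct.rid k B2).toLinearMap ∘ₗ TensorProduct.map LinearMap.id eps1 ∘ₗ coactL =
      eta2 ∘ₗ eps1

noncomputable def ax_eps2_actR (m1 : (B1 ⊗[k] B1) →ₗ[k] B1) (eta1 : k →ₗ[k] B1)
    (delta1 : B1 →ₗ[k] (B1 ⊗[k] B1)) (eps1 : B1 →ₗ[k] k)
    (m2 : (B2 ⊗[k] B2) →ₗ[k] B2) (eta2 : k →ₗ[k] B2)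
    (delta2 : B2 →ₗ[k] (B2 ⊗[k] B2)) (eps2 : B2 →ₗ[k] k)
    (actL : (B2 ⊗[k] B1) →ₗ[k] B1) (coactL : B1 →ₗ[k] (B2 ⊗[k] B1))
    (actR : (B2 ⊗[k] B1) →ₗ[k] B2) (coactR : B2 →ₗ[k] (B2 ⊗[k] B1)) : Prop :=
    eps2 ∘ₗ actR = LinearMap.mul' k k ∘ₗ TensorProduct.map eps2 eps1

noncomputable def ax_eps1_actL (m1 : (B1 ⊗[k] B1) →ₗ[k] B1) (eta1 : k →ₗ[k] B1)
    (delta1 : B1 →ₗ[k] (B1 ⊗[k] B1)) (eps1 : B1 →ₗ[k] k)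
    (m2 : (B2 ⊗[k] B2) →ₗ[k] B2) (eta2 : k →ₗ[k] B2)
    (delta2 : B2 →ₗ[k] (B2 ⊗[k] B2)) (eps2 : B2 →ₗ[k] k)
    (actL : (B2 ⊗[k] B1) →ₗ[k] B1) (coactL : B1 →ₗ[k] (B2 ⊗[k] B1))
    (actR : (B2 ⊗[k] B1) →ₗ[k] B2) (coactR : B2 →ₗ[k] (B2 ⊗[k] B1)) : Prop :=
    eps1 ∘ₗ actL = LinearMap.mul' k k ∘ₗ TensorProduct.map eps2 eps1

noncomputable def ax_actL_eta1 (m1 : (B1 ⊗[k] B1) →ₗ[k] B1) (eta1 : k →ₗ[k] B1)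
    (delta1 : B1 →ₗ[k] (B1 ⊗[k] B1)) (eps1 : B1 →ₗ[k] k)
    (m2 : (B2 ⊗[k] B2) →ₗ[k] B2) (eta2 : k →ₗ[k] B2)
    (delta2 : B2 →ₗ[k] (B2 ⊗[k] B2)) (eps2 : B2 →ₗ[k] k)
    (actL : (B2 ⊗[k] B1) →ₗ[k] B1) (coactL : B1 →ₗ[k] (B2 ⊗[k] B1))
    (actR : (B2 ⊗[k] B1) →ₗ[k] B2) (coactR : B2 →ₗ[k] (B2 ⊗[k] B1)) : Prop :=
    actL ∘ₗ TensorProduct.map LinearMap.id eta1 ∘ₗ (TensorProduct.rid k B2).symm.toLinearMap =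
      eta1 ∘ₗ eps2

noncomputable def ax_coactR_eps2 (m1 : (B1 ⊗[k] B1) →ₗ[k] B1) (eta1 : k →ₗ[k] B1)
    (delta1 : B1 →ₗ[k] (B1 ⊗[k] B1)) (eps1 : B1 →ₗ[k] k)
    (m2 : (B2 ⊗[k] B2) →ₗ[k] B2) (eta2 : k →ₗ[k] B2)
    (delta2 : B2 →ₗ[k] (B2 ⊗[k] B2)) (eps2 : B2 →ₗ[k] k)
    (actL : (B2 ⊗[k] B1) →ₗ[k] B1) (coactL : B1 →ₗ[k] (B2 ⊗[k] B1))
    (actR : (B2 ⊗[k] B1) →ₗ[k] B2) (coactR : B2 →ₗ[k] (B2 ⊗[k] B1)) : Prop :=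
    (TensorProduct.lid k B1).toLinearMap ∘ₗ TensorProduct.map eps2 LinearMap.id ∘ₗ coactR =
      eta1 ∘ₗ eps2

noncomputable def ax_coactR_eta2 (m1 : (B1 ⊗[k] B1) →ₗ[k] B1) (eta1 : k →ₗ[k] B1)
    (delta1 : B1 →ₗ[k] (B1 ⊗[k] B1)) (eps1 : B1 →ₗ[k] k)
    (m2 : (B2 ⊗[k] B2) →ₗ[k] B2) (eta2 : k →ₗ[k] B2)
    (delta2 : B2 →ₗ[k] (B2 ⊗[k] B2)) (eps2 : B2 →ₗ[k] k)
    (actL : (B2 ⊗[k] B1) →ₗ[k] B1) (coactL : B1 →ₗ[k] (B2 ⊗[k] B1))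
    (actR : (B2 ⊗[k] B1) →ₗ[k] B2) (coactR : B2 →ₗ[k] (B2 ⊗[k] B1)) : Prop :=
    coactR ∘ₗ eta2 = TensorProduct.map eta2 eta1 ∘ₗ (TensorProduct.lid k k).symm.toLinearMap

noncomputable def ax_coactL_eta1 (m1 : (B1 ⊗[k] B1) →ₗ[k] B1) (eta1 : k →ₗ[k] B1)
    (delta1 : B1 →ₗ[k] (B1 ⊗[k] B1)) (eps1 : B1 →ₗ[k] k)
    (m2 : (B2 ⊗[k] B2) →ₗ[k] B2) (eta2 : k →ₗ[k] B2)
    (delta2 : B2 →ₗ[k] (B2 ⊗[k] B2)) (eps2 : B2 →ₗ[k] k)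
    (actL : (B2 ⊗[k] B1) →ₗ[k] B1) (coactL : B1 →ₗ[k] (B2 ⊗[k] B1))
    (actR : (B2 ⊗[k] B1) →ₗ[k] B2) (coactR : B2 →ₗ[k] (B2 ⊗[k] B1)) : Prop :=
    coactL ∘ₗ eta1 = TensorProduct.map eta2 eta1 ∘ₗ (TensorProduct.lid k k).symm.toLinearMap

noncomputable def ax_algCoalg1 (m1 : (B1 ⊗[k] B1) →ₗ[k] B1) (eta1 : k →ₗ[k] B1)
    (delta1 : B1 →ₗ[k] (B1 ⊗[k] B1)) (eps1 : B1 →ₗ[k] k)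
    (m2 : (B2 ⊗[k] B2) →ₗ[k] B2) (eta2 : k →ₗ[k] B2)
    (delta2 : B2 →ₗ[k] (B2 ⊗[k] B2)) (eps2 : B2 →ₗ[k] k)
    (actL : (B2 ⊗[k] B1) →ₗ[k] B1) (coactL : B1 →ₗ[k] (B2 ⊗[k] B1))
    (actR : (B2 ⊗[k] B1) →ₗ[k] B2) (coactR : B2 →ₗ[k] (B2 ⊗[k] B1)) : Prop :=
    (delta1 : B1 →ₗ[k] (B1 ⊗[k] B1))
      ∘ₗ (m1 : (B1 ⊗[k] B1) →ₗ[k] B1)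
    =
    ((skp m1) : (B1 ⊗[k] (B1 ⊗[k] B1)) →ₗ[k] (B1 ⊗[k] B1))
      ∘ₗ ((merge2 m1) : (B1 ⊗[k] (B1 ⊗[k] (B1 ⊗[k] B1))) →ₗ[k] (B1 ⊗[k] (B1 ⊗[k] B1)))
      ∘ₗ ((skp (merge2 actL)) : (B1 ⊗[k] (B2 ⊗[k] (B1 ⊗[k] (B1 ⊗[k] B1)))) →ₗ[k] (B1 ⊗[k] (B1 ⊗[k] (B1 ⊗[k] B1))))
      ∘ₗ ((skp (skp swap2)) : (B1 ⊗[k] (B2 ⊗[k] (B1 ⊗[k] (B1 ⊗[k] B1)))) →ₗ[k] (B1 ⊗[k] (B2 ⊗[k] (B1 ⊗[k] (B1 ⊗[k] B1)))))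
      ∘ₗ ((skp (split2 coactL)) : (B1 ⊗[k] (B1 ⊗[k] (B1 ⊗[k] B1))) →ₗ[k] (B1 ⊗[k] (B2 ⊗[k] (B1 ⊗[k] (B1 ⊗[k] B1)))))
      ∘ₗ ((skp (skp delta1)) : (B1 ⊗[k] (B1 ⊗[k] B1)) →ₗ[k] (B1 ⊗[k] (B1 ⊗[k] (B1 ⊗[k] B1))))
      ∘ₗ ((split2 delta1) : (B1 ⊗[k] B1) →ₗ[k] (B1 ⊗[k] (B1 ⊗[k] B1)))

noncomputable def ax_algCoalg2 (m1 : (B1 ⊗[k] B1) →ₗ[k] B1) (eta1 : k →ₗ[k] B1)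
    (delta1 : B1 →ₗ[k] (B1 ⊗[k] B1)) (eps1 : B1 →ₗ[k] k)
    (m2 : (B2 ⊗[k] B2) →ₗ[k] B2) (eta2 : k →ₗ[k] B2)
    (delta2 : B2 →ₗ[k] (B2 ⊗[k] B2)) (eps2 : B2 →ₗ[k] k)
    (actL : (B2 ⊗[k] B1) →ₗ[k] B1) (coactL : B1 →ₗ[k] (B2 ⊗[k] B1))
    (actR : (B2 ⊗[k] B1) →ₗ[k] B2) (coactR : B2 →ₗ[k] (B2 ⊗[k] B1)) : Prop :=
    (delta2 : B2 →ₗ[k] (B2 ⊗[k] B2))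
      ∘ₗ (m2 : (B2 ⊗[k] B2) →ₗ[k] B2)
    =
    ((skp m2) : (B2 ⊗[k] (B2 ⊗[k] B2)) →ₗ[k] (B2 ⊗[k] B2))
      ∘ₗ ((merge2 m2) : (B2 ⊗[k] (B2 ⊗[k] (B2 ⊗[k] B2))) →ₗ[k] (B2 ⊗[k] (B2 ⊗[k] B2)))
      ∘ₗ ((skp (skp (merge2 actR))) : (B2 ⊗[k] (B2 ⊗[k] (B2 ⊗[k] (B1 ⊗[k] B2)))) →ₗ[k] (B2 ⊗[k] (B2 ⊗[k] (B2 ⊗[k] B2))))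
      ∘ₗ ((skp swap2) : (B2 ⊗[k] (B2 ⊗[k] (B2 ⊗[k] (B1 ⊗[k] B2)))) →ₗ[k] (B2 ⊗[k] (B2 ⊗[k] (B2 ⊗[k] (B1 ⊗[k] B2)))))
      ∘ₗ ((skp (skp (split2 coactR))) : (B2 ⊗[k] (B2 ⊗[k] (B2 ⊗[k] B2))) →ₗ[k] (B2 ⊗[k] (B2 ⊗[k] (B2 ⊗[k] (B1 ⊗[k] B2)))))
      ∘ₗ ((skp (skp delta2)) : (B2 ⊗[k] (B2 ⊗[k] B2)) →ₗ[k] (B2 ⊗[k] (B2 ⊗[k] (B2 ⊗[k] B2))))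
      ∘ₗ ((split2 delta2) : (B2 ⊗[k] B2) →ₗ[k] (B2 ⊗[k] (B2 ⊗[k] B2)))

noncomputable def ax_modComod (m1 : (B1 ⊗[k] B1) →ₗ[k] B1) (eta1 : k →ₗ[k] B1)
    (delta1 : B1 →ₗ[k] (B1 ⊗[k] B1)) (eps1 : B1 →ₗ[k] k)
    (m2 : (B2 ⊗[k] B2) →ₗ[k] B2) (eta2 : k →ₗ[k] B2)
    (delta2 : B2 →ₗ[k] (B2 ⊗[k] B2)) (eps2 : B2 →ₗ[k] k)
    (actL : (B2 ⊗[k] B1) →ₗ[k] B1) (coactL : B1 →ₗ[k] (B2 ⊗[k] B1))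
    (actR : (B2 ⊗[k] B1) →ₗ[k] B2) (coactR : B2 →ₗ[k] (B2 ⊗[k] B1)) : Prop :=
    ((skp m1) : (B2 ⊗[k] (B1 ⊗[k] B1)) →ₗ[k] (B2 ⊗[k] B1))
      ∘ₗ ((merge2 m2) : (B2 ⊗[k] (B2 ⊗[k] (B1 ⊗[k] B1))) →ₗ[k] (B2 ⊗[k] (B1 ⊗[k] B1)))
      ∘ₗ ((skp swap2) : (B2 ⊗[k] (B1 ⊗[k] (B2 ⊗[k] B1))) →ₗ[k] (B2 ⊗[k] (B2 ⊗[k] (B1 ⊗[k] B1))))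
      ∘ₗ ((skp (skp coactR)) : (B2 ⊗[k] (B1 ⊗[k] B2)) →ₗ[k] (B2 ⊗[k] (B1 ⊗[k] (B2 ⊗[k] B1))))
      ∘ₗ ((split2 coactL) : (B1 ⊗[k] B2) →ₗ[k] (B2 ⊗[k] (B1 ⊗[k] B2)))
      ∘ₗ ((skp actR) : (B1 ⊗[k] (B2 ⊗[k] B1)) →ₗ[k] (B1 ⊗[k] B2))
      ∘ₗ ((merge2 actL) : (B2 ⊗[k] (B1 ⊗[k] (B2 ⊗[k] B1))) →ₗ[k] (B1 ⊗[k] (B2 ⊗[k] B1)))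
      ∘ₗ ((skp swap2) : (B2 ⊗[k] (B2 ⊗[k] (B1 ⊗[k] B1))) →ₗ[k] (B2 ⊗[k] (B1 ⊗[k] (B2 ⊗[k] B1))))
      ∘ₗ ((skp (skp delta1)) : (B2 ⊗[k] (B2 ⊗[k] B1)) →ₗ[k] (B2 ⊗[k] (B2 ⊗[k] (B1 ⊗[k] B1))))
      ∘ₗ ((split2 delta2) : (B2 ⊗[k] B1) →ₗ[k] (B2 ⊗[k] (B2 ⊗[k] B1)))
    =
    ((skp m1) : (B2 ⊗[k] (B1 ⊗[k] B1)) →ₗ[k] (B2 ⊗[k] B1))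
      ∘ₗ ((merge2 m2) : (B2 ⊗[k] (B2 ⊗[k] (B1 ⊗[k] B1))) →ₗ[k] (B2 ⊗[k] (B1 ⊗[k] B1)))
      ∘ₗ ((skp (skp (skp actL))) : (B2 ⊗[k] (B2 ⊗[k] (B1 ⊗[k] (B2 ⊗[k] B1)))) →ₗ[k] (B2 ⊗[k] (B2 ⊗[k] (B1 ⊗[k] B1))))
      ∘ₗ ((skp swap2) : (B2 ⊗[k] (B1 ⊗[k] (B2 ⊗[k] (B2 ⊗[k] B1)))) →ₗ[k] (B2 ⊗[k] (B2 ⊗[k] (B1 ⊗[k] (B2 ⊗[k] B1)))))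
      ∘ₗ ((merge2 actR) : (B2 ⊗[k] (B1 ⊗[k] (B1 ⊗[k] (B2 ⊗[k] (B2 ⊗[k] B1))))) →ₗ[k] (B2 ⊗[k] (B1 ⊗[k] (B2 ⊗[k] (B2 ⊗[k] B1)))))
      ∘ₗ ((skp (skp (skp swap2))) : (B2 ⊗[k] (B1 ⊗[k] (B1 ⊗[k] (B2 ⊗[k] (B2 ⊗[k] B1))))) →ₗ[k] (B2 ⊗[k] (B1 ⊗[k] (B1 ⊗[k] (B2 ⊗[k] (B2 ⊗[k] B1))))))
      ∘ₗ ((skp swap2) : (B2 ⊗[k] (B1 ⊗[k] (B1 ⊗[k] (B2 ⊗[k] (B2 ⊗[k] B1))))) →ₗ[k] (B2 ⊗[k] (B1 ⊗[k] (B1 ⊗[k] (B2 ⊗[k] (B2 ⊗[k] B1))))))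
      ∘ₗ ((skp (skp (skp (skp coactL)))) : (B2 ⊗[k] (B1 ⊗[k] (B1 ⊗[k] (B2 ⊗[k] B1)))) →ₗ[k] (B2 ⊗[k] (B1 ⊗[k] (B1 ⊗[k] (B2 ⊗[k] (B2 ⊗[k] B1))))))
      ∘ₗ ((skp (skp swap2)) : (B2 ⊗[k] (B1 ⊗[k] (B2 ⊗[k] (B1 ⊗[k] B1)))) →ₗ[k] (B2 ⊗[k] (B1 ⊗[k] (B1 ⊗[k] (B2 ⊗[k] B1)))))
      ∘ₗ ((split2 coactR) : (B2 ⊗[k] (B2 ⊗[k] (B1 ⊗[k] B1))) →ₗ[k] (B2 ⊗[k] (B1 ⊗[k] (B2 ⊗[k] (B1 ⊗[k] B1)))))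
      ∘ₗ ((skp (skp delta1)) : (B2 ⊗[k] (B2 ⊗[k] B1)) →ₗ[k] (B2 ⊗[k] (B2 ⊗[k] (B1 ⊗[k] B1))))
      ∘ₗ ((split2 delta2) : (B2 ⊗[k] B1) →ₗ[k] (B2 ⊗[k] (B2 ⊗[k] B1)))

noncomputable def ax_modAlg1 (m1 : (B1 ⊗[k] B1) →ₗ[k] B1) (eta1 : k →ₗ[k] B1)
    (delta1 : B1 →ₗ[k] (B1 ⊗[k] B1)) (eps1 : B1 →ₗ[k] k)
    (m2 : (B2 ⊗[k] B2) →ₗ[k] B2) (eta2 : k →ₗ[k] B2)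
    (delta2 : B2 →ₗ[k] (B2 ⊗[k] B2)) (eps2 : B2 →ₗ[k] k)
    (actL : (B2 ⊗[k] B1) →ₗ[k] B1) (coactL : B1 →ₗ[k] (B2 ⊗[k] B1))
    (actR : (B2 ⊗[k] B1) →ₗ[k] B2) (coactR : B2 →ₗ[k] (B2 ⊗[k] B1)) : Prop :=
    (actR : (B2 ⊗[k] B1) →ₗ[k] B2)
      ∘ₗ ((merge2 m2) : (B2 ⊗[k] (B2 ⊗[k] B1)) →ₗ[k] (B2 ⊗[k] B1))
    =
    (m2 : (B2 ⊗[k] B2) →ₗ[k] B2)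
      ∘ₗ ((merge2 actR) : (B2 ⊗[k] (B1 ⊗[k] B2)) →ₗ[k] (B2 ⊗[k] B2))
      ∘ₗ ((skp (skp actR)) : (B2 ⊗[k] (B1 ⊗[k] (B2 ⊗[k] B1))) →ₗ[k] (B2 ⊗[k] (B1 ⊗[k] B2)))
      ∘ₗ ((skp (merge2 actL)) : (B2 ⊗[k] (B2 ⊗[k] (B1 ⊗[k] (B2 ⊗[k] B1)))) →ₗ[k] (B2 ⊗[k] (B1 ⊗[k] (B2 ⊗[k] B1))))
      ∘ₗ ((skp (skp swap2)) : (B2 ⊗[k] (B2 ⊗[k] (B2 ⊗[k] (B1 ⊗[k] B1)))) →ₗ[k] (B2 ⊗[k] (B2 ⊗[k] (B1 ⊗[k] (B2 ⊗[k] B1)))))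
      ∘ₗ ((skp (skp (skp delta1))) : (B2 ⊗[k] (B2 ⊗[k] (B2 ⊗[k] B1))) →ₗ[k] (B2 ⊗[k] (B2 ⊗[k] (B2 ⊗[k] (B1 ⊗[k] B1)))))
      ∘ₗ ((skp (split2 delta2)) : (B2 ⊗[k] (B2 ⊗[k] B1)) →ₗ[k] (B2 ⊗[k] (B2 ⊗[k] (B2 ⊗[k] B1))))

noncomputable def ax_modAlg2 (m1 : (B1 ⊗[k] B1) →ₗ[k] B1) (eta1 : k →ₗ[k] B1)
    (delta1 : B1 →ₗ[k] (B1 ⊗[k] B1)) (eps1 : B1 →ₗ[k] k)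
    (m2 : (B2 ⊗[k] B2) →ₗ[k] B2) (eta2 : k →ₗ[k] B2)
    (delta2 : B2 →ₗ[k] (B2 ⊗[k] B2)) (eps2 : B2 →ₗ[k] k)
    (actL : (B2 ⊗[k] B1) →ₗ[k] B1) (coactL : B1 →ₗ[k] (B2 ⊗[k] B1))
    (actR : (B2 ⊗[k] B1) →ₗ[k] B2) (coactR : B2 →ₗ[k] (B2 ⊗[k] B1)) : Prop :=
    (actL : (B2 ⊗[k] B1) →ₗ[k] B1)
      ∘ₗ ((skp m1) : (B2 ⊗[k] (B1 ⊗[k] B1)) →ₗ[k] (B2 ⊗[k] B1))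
    =
    (m1 : (B1 ⊗[k] B1) →ₗ[k] B1)
      ∘ₗ ((skp actL) : (B1 ⊗[k] (B2 ⊗[k] B1)) →ₗ[k] (B1 ⊗[k] B1))
      ∘ₗ ((skp (merge2 actR)) : (B1 ⊗[k] (B2 ⊗[k] (B1 ⊗[k] B1))) →ₗ[k] (B1 ⊗[k] (B2 ⊗[k] B1)))
      ∘ₗ ((merge2 actL) : (B2 ⊗[k] (B1 ⊗[k] (B2 ⊗[k] (B1 ⊗[k] B1)))) →ₗ[k] (B1 ⊗[k] (B2 ⊗[k] (B1 ⊗[k] B1))))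
      ∘ₗ ((skp swap2) : (B2 ⊗[k] (B2 ⊗[k] (B1 ⊗[k] (B1 ⊗[k] B1)))) →ₗ[k] (B2 ⊗[k] (B1 ⊗[k] (B2 ⊗[k] (B1 ⊗[k] B1)))))
      ∘ₗ ((skp (skp (split2 delta1))) : (B2 ⊗[k] (B2 ⊗[k] (B1 ⊗[k] B1))) →ₗ[k] (B2 ⊗[k] (B2 ⊗[k] (B1 ⊗[k] (B1 ⊗[k] B1)))))
      ∘ₗ ((split2 delta2) : (B2 ⊗[k] (B1 ⊗[k] B1)) →ₗ[k] (B2 ⊗[k] (B2 ⊗[k] (B1 ⊗[k] B1))))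

noncomputable def ax_comodCoalg1 (m1 : (B1 ⊗[k] B1) →ₗ[k] B1) (eta1 : k →ₗ[k] B1)
    (delta1 : B1 →ₗ[k] (B1 ⊗[k] B1)) (eps1 : B1 →ₗ[k] k)
    (m2 : (B2 ⊗[k] B2) →ₗ[k] B2) (eta2 : k →ₗ[k] B2)
    (delta2 : B2 →ₗ[k] (B2 ⊗[k] B2)) (eps2 : B2 →ₗ[k] k)
    (actL : (B2 ⊗[k] B1) →ₗ[k] B1) (coactL : B1 →ₗ[k] (B2 ⊗[k] B1))
    (actR : (B2 ⊗[k] B1) →ₗ[k] B2) (coactR : B2 →ₗ[k] (B2 ⊗[k] B1)) : Prop :=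
    ((split2 delta2) : (B2 ⊗[k] B1) →ₗ[k] (B2 ⊗[k] (B2 ⊗[k] B1)))
      ∘ₗ (coactR : B2 →ₗ[k] (B2 ⊗[k] B1))
    =
    ((skp (skp m1)) : (B2 ⊗[k] (B2 ⊗[k] (B1 ⊗[k] B1))) →ₗ[k] (B2 ⊗[k] (B2 ⊗[k] B1)))
      ∘ₗ ((skp (merge2 m2)) : (B2 ⊗[k] (B2 ⊗[k] (B2 ⊗[k] (B1 ⊗[k] B1)))) →ₗ[k] (B2 ⊗[k] (B2 ⊗[k] (B1 ⊗[k] B1))))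
      ∘ₗ ((skp (skp swap2)) : (B2 ⊗[k] (B2 ⊗[k] (B1 ⊗[k] (B2 ⊗[k] B1)))) →ₗ[k] (B2 ⊗[k] (B2 ⊗[k] (B2 ⊗[k] (B1 ⊗[k] B1)))))
      ∘ₗ ((skp (skp (skp coactR))) : (B2 ⊗[k] (B2 ⊗[k] (B1 ⊗[k] B2))) →ₗ[k] (B2 ⊗[k] (B2 ⊗[k] (B1 ⊗[k] (B2 ⊗[k] B1)))))
      ∘ₗ ((skp (split2 coactL)) : (B2 ⊗[k] (B1 ⊗[k] B2)) →ₗ[k] (B2 ⊗[k] (B2 ⊗[k] (B1 ⊗[k] B2))))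
      ∘ₗ ((split2 coactR) : (B2 ⊗[k] B2) →ₗ[k] (B2 ⊗[k] (B1 ⊗[k] B2)))
      ∘ₗ (delta2 : B2 →ₗ[k] (B2 ⊗[k] B2))

noncomputable def ax_comodCoalg2 (m1 : (B1 ⊗[k] B1) →ₗ[k] B1) (eta1 : k →ₗ[k] B1)
    (delta1 : B1 →ₗ[k] (B1 ⊗[k] B1)) (eps1 : B1 →ₗ[k] k)
    (m2 : (B2 ⊗[k] B2) →ₗ[k] B2) (eta2 : k →ₗ[k] B2)
    (delta2 : B2 →ₗ[k] (B2 ⊗[k] B2)) (eps2 : B2 →ₗ[k] k)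
    (actL : (B2 ⊗[k] B1) →ₗ[k] B1) (coactL : B1 →ₗ[k] (B2 ⊗[k] B1))
    (actR : (B2 ⊗[k] B1) →ₗ[k] B2) (coactR : B2 →ₗ[k] (B2 ⊗[k] B1)) : Prop :=
    ((skp delta1) : (B2 ⊗[k] B1) →ₗ[k] (B2 ⊗[k] (B1 ⊗[k] B1)))
      ∘ₗ (coactL : B1 →ₗ[k] (B2 ⊗[k] B1))
    =
    ((skp (merge2 m1)) : (B2 ⊗[k] (B1 ⊗[k] (B1 ⊗[k] B1))) →ₗ[k] (B2 ⊗[k] (B1 ⊗[k] B1)))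
      ∘ₗ ((merge2 m2) : (B2 ⊗[k] (B2 ⊗[k] (B1 ⊗[k] (B1 ⊗[k] B1)))) →ₗ[k] (B2 ⊗[k] (B1 ⊗[k] (B1 ⊗[k] B1))))
      ∘ₗ ((skp swap2) : (B2 ⊗[k] (B1 ⊗[k] (B2 ⊗[k] (B1 ⊗[k] B1)))) →ₗ[k] (B2 ⊗[k] (B2 ⊗[k] (B1 ⊗[k] (B1 ⊗[k] B1)))))
      ∘ₗ ((skp (skp (split2 coactR))) : (B2 ⊗[k] (B1 ⊗[k] (B2 ⊗[k] B1))) →ₗ[k] (B2 ⊗[k] (B1 ⊗[k] (B2 ⊗[k] (B1 ⊗[k] B1)))))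
      ∘ₗ ((skp (skp coactL)) : (B2 ⊗[k] (B1 ⊗[k] B1)) →ₗ[k] (B2 ⊗[k] (B1 ⊗[k] (B2 ⊗[k] B1))))
      ∘ₗ ((split2 coactL) : (B1 ⊗[k] B1) →ₗ[k] (B2 ⊗[k] (B1 ⊗[k] B1)))
      ∘ₗ (delta1 : B1 →ₗ[k] (B1 ⊗[k] B1))

noncomputable def ax_modCoalg1 (m1 : (B1 ⊗[k] B1) →ₗ[k] B1) (eta1 : k →ₗ[k] B1)
    (delta1 : B1 →ₗ[k] (B1 ⊗[k] B1)) (eps1 : B1 →ₗ[k] k)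
    (m2 : (B2 ⊗[k] B2) →ₗ[k] B2) (eta2 : k →ₗ[k] B2)
    (delta2 : B2 →ₗ[k] (B2 ⊗[k] B2)) (eps2 : B2 →ₗ[k] k)
    (actL : (B2 ⊗[k] B1) →ₗ[k] B1) (coactL : B1 →ₗ[k] (B2 ⊗[k] B1))
    (actR : (B2 ⊗[k] B1) →ₗ[k] B2) (coactR : B2 →ₗ[k] (B2 ⊗[k] B1)) : Prop :=
    (delta2 : B2 →ₗ[k] (B2 ⊗[k] B2))
      ∘ₗ (actR : (B2 ⊗[k] B1) →ₗ[k] B2)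
    =
    ((merge2 m2) : (B2 ⊗[k] (B2 ⊗[k] B2)) →ₗ[k] (B2 ⊗[k] B2))
      ∘ₗ ((skp (skp actR)) : (B2 ⊗[k] (B2 ⊗[k] (B2 ⊗[k] B1))) →ₗ[k] (B2 ⊗[k] (B2 ⊗[k] B2)))
      ∘ₗ ((skp swap2) : (B2 ⊗[k] (B2 ⊗[k] (B2 ⊗[k] B1))) →ₗ[k] (B2 ⊗[k] (B2 ⊗[k] (B2 ⊗[k] B1))))
      ∘ₗ ((merge2 actR) : (B2 ⊗[k] (B1 ⊗[k] (B2 ⊗[k] (B2 ⊗[k] B1)))) →ₗ[k] (B2 ⊗[k] (B2 ⊗[k] (B2 ⊗[k] B1))))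
      ∘ₗ ((skp (skp (skp coactL))) : (B2 ⊗[k] (B1 ⊗[k] (B2 ⊗[k] B1))) →ₗ[k] (B2 ⊗[k] (B1 ⊗[k] (B2 ⊗[k] (B2 ⊗[k] B1)))))
      ∘ₗ ((skp swap2) : (B2 ⊗[k] (B2 ⊗[k] (B1 ⊗[k] B1))) →ₗ[k] (B2 ⊗[k] (B1 ⊗[k] (B2 ⊗[k] B1))))
      ∘ₗ ((skp (skp delta1)) : (B2 ⊗[k] (B2 ⊗[k] B1)) →ₗ[k] (B2 ⊗[k] (B2 ⊗[k] (B1 ⊗[k] B1))))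
      ∘ₗ ((split2 delta2) : (B2 ⊗[k] B1) →ₗ[k] (B2 ⊗[k] (B2 ⊗[k] B1)))

noncomputable def ax_modCoalg2 (m1 : (B1 ⊗[k] B1) →ₗ[k] B1) (eta1 : k →ₗ[k] B1)
    (delta1 : B1 →ₗ[k] (B1 ⊗[k] B1)) (eps1 : B1 →ₗ[k] k)
    (m2 : (B2 ⊗[k] B2) →ₗ[k] B2) (eta2 : k →ₗ[k] B2)
    (delta2 : B2 →ₗ[k] (B2 ⊗[k] B2)) (eps2 : B2 →ₗ[k] k)
    (actL : (B2 ⊗[k] B1) →ₗ[k] B1) (coactL : B1 →ₗ[k] (B2 ⊗[k] B1))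
    (actR : (B2 ⊗[k] B1) →ₗ[k] B2) (coactR : B2 →ₗ[k] (B2 ⊗[k] B1)) : Prop :=
    (delta1 : B1 →ₗ[k] (B1 ⊗[k] B1))
      ∘ₗ (actL : (B2 ⊗[k] B1) →ₗ[k] B1)
    =
    ((skp m1) : (B1 ⊗[k] (B1 ⊗[k] B1)) →ₗ[k] (B1 ⊗[k] B1))
      ∘ₗ ((skp (skp actL)) : (B1 ⊗[k] (B1 ⊗[k] (B2 ⊗[k] B1))) →ₗ[k] (B1 ⊗[k] (B1 ⊗[k] B1)))
      ∘ₗ ((merge2 actL) : (B2 ⊗[k] (B1 ⊗[k] (B1 ⊗[k] (B2 ⊗[k] B1)))) →ₗ[k] (B1 ⊗[k] (B1 ⊗[k] (B2 ⊗[k] B1))))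
      ∘ₗ ((skp swap2) : (B2 ⊗[k] (B1 ⊗[k] (B1 ⊗[k] (B2 ⊗[k] B1)))) →ₗ[k] (B2 ⊗[k] (B1 ⊗[k] (B1 ⊗[k] (B2 ⊗[k] B1)))))
      ∘ₗ ((split2 coactR) : (B2 ⊗[k] (B1 ⊗[k] (B2 ⊗[k] B1))) →ₗ[k] (B2 ⊗[k] (B1 ⊗[k] (B1 ⊗[k] (B2 ⊗[k] B1)))))
      ∘ₗ ((skp swap2) : (B2 ⊗[k] (B2 ⊗[k] (B1 ⊗[k] B1))) →ₗ[k] (B2 ⊗[k] (B1 ⊗[k] (B2 ⊗[k] B1))))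
      ∘ₗ ((skp (skp delta1)) : (B2 ⊗[k] (B2 ⊗[k] B1)) →ₗ[k] (B2 ⊗[k] (B2 ⊗[k] (B1 ⊗[k] B1))))
      ∘ₗ ((split2 delta2) : (B2 ⊗[k] B1) →ₗ[k] (B2 ⊗[k] (B2 ⊗[k] B1)))

noncomputable def ax_comodAlg1 (m1 : (B1 ⊗[k] B1) →ₗ[k] B1) (eta1 : k →ₗ[k] B1)
    (delta1 : B1 →ₗ[k] (B1 ⊗[k] B1)) (eps1 : B1 →ₗ[k] k)
    (m2 : (B2 ⊗[k] B2) →ₗ[k] B2) (eta2 : k →ₗ[k] B2)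
    (delta2 : B2 →ₗ[k] (B2 ⊗[k] B2)) (eps2 : B2 →ₗ[k] k)
    (actL : (B2 ⊗[k] B1) →ₗ[k] B1) (coactL : B1 →ₗ[k] (B2 ⊗[k] B1))
    (actR : (B2 ⊗[k] B1) →ₗ[k] B2) (coactR : B2 →ₗ[k] (B2 ⊗[k] B1)) : Prop :=
    (coactR : B2 →ₗ[k] (B2 ⊗[k] B1))
      ∘ₗ (m2 : (B2 ⊗[k] B2) →ₗ[k] B2)
    =
    ((skp m1) : (B2 ⊗[k] (B1 ⊗[k] B1)) →ₗ[k] (B2 ⊗[k] B1))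
      ∘ₗ ((skp (skp actL)) : (B2 ⊗[k] (B1 ⊗[k] (B2 ⊗[k] B1))) →ₗ[k] (B2 ⊗[k] (B1 ⊗[k] B1)))
      ∘ₗ ((merge2 m2) : (B2 ⊗[k] (B2 ⊗[k] (B1 ⊗[k] (B2 ⊗[k] B1)))) →ₗ[k] (B2 ⊗[k] (B1 ⊗[k] (B2 ⊗[k] B1))))
      ∘ₗ ((skp swap2) : (B2 ⊗[k] (B1 ⊗[k] (B2 ⊗[k] (B2 ⊗[k] B1)))) →ₗ[k] (B2 ⊗[k] (B2 ⊗[k] (B1 ⊗[k] (B2 ⊗[k] B1)))))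
      ∘ₗ ((skp (skp swap2)) : (B2 ⊗[k] (B1 ⊗[k] (B2 ⊗[k] (B2 ⊗[k] B1)))) →ₗ[k] (B2 ⊗[k] (B1 ⊗[k] (B2 ⊗[k] (B2 ⊗[k] B1)))))
      ∘ₗ ((skp (skp (skp coactR))) : (B2 ⊗[k] (B1 ⊗[k] (B2 ⊗[k] B2))) →ₗ[k] (B2 ⊗[k] (B1 ⊗[k] (B2 ⊗[k] (B2 ⊗[k] B1)))))
      ∘ₗ ((split2 coactR) : (B2 ⊗[k] (B2 ⊗[k] B2)) →ₗ[k] (B2 ⊗[k] (B1 ⊗[k] (B2 ⊗[k] B2))))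
      ∘ₗ ((split2 delta2) : (B2 ⊗[k] B2) →ₗ[k] (B2 ⊗[k] (B2 ⊗[k] B2)))

noncomputable def ax_comodAlg2 (m1 : (B1 ⊗[k] B1) →ₗ[k] B1) (eta1 : k →ₗ[k] B1)
    (delta1 : B1 →ₗ[k] (B1 ⊗[k] B1)) (eps1 : B1 →ₗ[k] k)
    (m2 : (B2 ⊗[k] B2) →ₗ[k] B2) (eta2 : k →ₗ[k] B2)
    (delta2 : B2 →ₗ[k] (B2 ⊗[k] B2)) (eps2 : B2 →ₗ[k] k)
    (actL : (B2 ⊗[k] B1) →ₗ[k] B1) (coactL : B1 →ₗ[k] (B2 ⊗[k] B1))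
    (actR : (B2 ⊗[k] B1) →ₗ[k] B2) (coactR : B2 →ₗ[k] (B2 ⊗[k] B1)) : Prop :=
    (coactL : B1 →ₗ[k] (B2 ⊗[k] B1))
      ∘ₗ (m1 : (B1 ⊗[k] B1) →ₗ[k] B1)
    =
    ((skp m1) : (B2 ⊗[k] (B1 ⊗[k] B1)) →ₗ[k] (B2 ⊗[k] B1))
      ∘ₗ ((merge2 m2) : (B2 ⊗[k] (B2 ⊗[k] (B1 ⊗[k] B1))) →ₗ[k] (B2 ⊗[k] (B1 ⊗[k] B1)))
      ∘ₗ ((skp swap2) : (B2 ⊗[k] (B1 ⊗[k] (B2 ⊗[k] B1))) →ₗ[k] (B2 ⊗[k] (B2 ⊗[k] (B1 ⊗[k] B1))))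
      ∘ₗ ((skp (skp coactL)) : (B2 ⊗[k] (B1 ⊗[k] B1)) →ₗ[k] (B2 ⊗[k] (B1 ⊗[k] (B2 ⊗[k] B1))))
      ∘ₗ ((merge2 actR) : (B2 ⊗[k] (B1 ⊗[k] (B1 ⊗[k] B1))) →ₗ[k] (B2 ⊗[k] (B1 ⊗[k] B1)))
      ∘ₗ ((skp swap2) : (B2 ⊗[k] (B1 ⊗[k] (B1 ⊗[k] B1))) →ₗ[k] (B2 ⊗[k] (B1 ⊗[k] (B1 ⊗[k] B1))))
      ∘ₗ ((skp (skp delta1)) : (B2 ⊗[k] (B1 ⊗[k] B1)) →ₗ[k] (B2 ⊗[k] (B1 ⊗[k] (B1 ⊗[k] B1))))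
      ∘ₗ ((split2 coactL) : (B1 ⊗[k] B1) →ₗ[k] (B2 ⊗[k] (B1 ⊗[k] B1)))


/-- A Hopf datum in the sense of Definition 2.5 of Bespalov-Drabant,
"Cross Product Bialgebras I", in the symmetric monoidal category of `k`-modules:
two objects which are both (counital) algebras and (unital) coalgebras, `B1` a left
`B2`-module and -comodule, `B2` a right `B1`-module and -comodule, subject to the
algebra-coalgebra, module-comodule, module-algebra, comodule-coalgebra, module-coalgebra
and comodule-algebra compatibilities. -/
structure HopfDatum where
  m1 : (B1 ⊗[k] B1) →ₗ[k] B1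
  eta1 : k →ₗ[k] B1
  delta1 : B1 →ₗ[k] (B1 ⊗[k] B1)
  eps1 : B1 →ₗ[k] k
  m2 : (B2 ⊗[k] B2) →ₗ[k] B2
  eta2 : k →ₗ[k] B2
  delta2 : B2 →ₗ[k] (B2 ⊗[k] B2)
  eps2 : B2 →ₗ[k] k
  actL : (B2 ⊗[k] B1) →ₗ[k] B1
  coactL : B1 →ₗ[k] (B2 ⊗[k] B1)
  actR : (B2 ⊗[k] B1) →ₗ[k] B2
  coactR : B2 →ₗ[k] (B2 ⊗[k] B1)
  alg1 : IsAlgMaps k B1 m1 eta1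
  coalg1 : IsCoalgMaps k B1 delta1 eps1
  alg2 : IsAlgMaps k B2 m2 eta2
  coalg2 : IsCoalgMaps k B2 delta2 eps2
  epseta1 : eps1 ∘ₗ eta1 = LinearMap.id
  epseta2 : eps2 ∘ₗ eta2 = LinearMap.id
  actL_act : ax_actL_act k B1 B2 m1 eta1 delta1 eps1 m2 eta2 delta2 eps2 actL coactL actR coactR
  actL_unit : ax_actL_unit k B1 B2 m1 eta1 delta1 eps1 m2 eta2 delta2 eps2 actL coactL actR coactR
  actR_act : ax_actR_act k B1 B2 m1 eta1 delta1 eps1 m2 eta2 delta2 eps2 actL coactL actR coactR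
  actR_unit : ax_actR_unit k B1 B2 m1 eta1 delta1 eps1 m2 eta2 delta2 eps2 actL coactL actR coactR
  coactL_coact : ax_coactL_coact k B1 B2 m1 eta1 delta1 eps1 m2 eta2 delta2 eps2 actL coactL actR coactR
  coactL_counit : ax_coactL_counit k B1 B2 m1 eta1 delta1 eps1 m2 eta2 delta2 eps2 actL coactL actR coactR
  coactR_coact : ax_coactR_coact k B1 B2 m1 eta1 delta1 eps1 m2 eta2 delta2 eps2 actL coactL actR coactR
  coactR_counit : ax_coactR_counit k B1 B2 m1 eta1 delta1 eps1 m2 eta2 delta2 eps2 actL coactL actR coactR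
  actR_eta2 : ax_actR_eta2 k B1 B2 m1 eta1 delta1 eps1 m2 eta2 delta2 eps2 actL coactL actR coactR
  coactL_eps1 : ax_coactL_eps1 k B1 B2 m1 eta1 delta1 eps1 m2 eta2 delta2 eps2 actL coactL actR coactR
  eps2_actR : ax_eps2_actR k B1 B2 m1 eta1 delta1 eps1 m2 eta2 delta2 eps2 actL coactL actR coactR
  eps1_actL : ax_eps1_actL k B1 B2 m1 eta1 delta1 eps1 m2 eta2 delta2 eps2 actL coactL actR coactR
  actL_eta1 : ax_actL_eta1 k B1 B2 m1 eta1 delta1 eps1 m2 eta2 delta2 eps2 actL coactL actR coactR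
  coactR_eps2 : ax_coactR_eps2 k B1 B2 m1 eta1 delta1 eps1 m2 eta2 delta2 eps2 actL coactL actR coactR
  coactR_eta2 : ax_coactR_eta2 k B1 B2 m1 eta1 delta1 eps1 m2 eta2 delta2 eps2 actL coactL actR coactR
  coactL_eta1 : ax_coactL_eta1 k B1 B2 m1 eta1 delta1 eps1 m2 eta2 delta2 eps2 actL coactL actR coactR
  algCoalg1 : ax_algCoalg1 k B1 B2 m1 eta1 delta1 eps1 m2 eta2 delta2 eps2 actL coactL actR coactR
  algCoalg2 : ax_algCoalg2 k B1 B2 m1 eta1 delta1 eps1 m2 eta2 delta2 eps2 actL coactL actR coactR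
  modComod : ax_modComod k B1 B2 m1 eta1 delta1 eps1 m2 eta2 delta2 eps2 actL coactL actR coactR
  modAlg1 : ax_modAlg1 k B1 B2 m1 eta1 delta1 eps1 m2 eta2 delta2 eps2 actL coactL actR coactR
  modAlg2 : ax_modAlg2 k B1 B2 m1 eta1 delta1 eps1 m2 eta2 delta2 eps2 actL coactL actR coactR
  comodCoalg1 : ax_comodCoalg1 k B1 B2 m1 eta1 delta1 eps1 m2 eta2 delta2 eps2 actL coactL actR coactR
  comodCoalg2 : ax_comodCoalg2 k B1 B2 m1 eta1 delta1 eps1 m2 eta2 delta2 eps2 actL coactL actR coactR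
  modCoalg1 : ax_modCoalg1 k B1 B2 m1 eta1 delta1 eps1 m2 eta2 delta2 eps2 actL coactL actR coactR
  modCoalg2 : ax_modCoalg2 k B1 B2 m1 eta1 delta1 eps1 m2 eta2 delta2 eps2 actL coactL actR coactR
  comodAlg1 : ax_comodAlg1 k B1 B2 m1 eta1 delta1 eps1 m2 eta2 delta2 eps2 actL coactL actR coactR
  comodAlg2 : ax_comodAlg2 k B1 B2 m1 eta1 delta1 eps1 m2 eta2 delta2 eps2 actL coactL actR coactR

end HopfDatumSection


section Derived
variable {k : Type*} [CommRing k] {B1 B2 : Type*}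
  [AddCommMonoid B1] [Module k B1] [AddCommMonoid B2] [Module k B2]

/-- `φ₂₁ = (μ_l ⊗ μ_r) ∘ (id ⊗ τ ⊗ id) ∘ (Δ₂ ⊗ Δ₁)` -/
noncomputable def mpPhi21 (delta1 : B1 →ₗ[k] (B1 ⊗[k] B1)) (delta2 : B2 →ₗ[k] (B2 ⊗[k] B2))
    (actL : (B2 ⊗[k] B1) →ₗ[k] B1) (actR : (B2 ⊗[k] B1) →ₗ[k] B2) :
    (B2 ⊗[k] B1) →ₗ[k] (B1 ⊗[k] B2) :=
  ((skp actR) : (B1 ⊗[k] (B2 ⊗[k] B1)) →ₗ[k] (B1 ⊗[k] B2))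
      ∘ₗ ((merge2 actL) : (B2 ⊗[k] (B1 ⊗[k] (B2 ⊗[k] B1))) →ₗ[k] (B1 ⊗[k] (B2 ⊗[k] B1)))
      ∘ₗ ((skp swap2) : (B2 ⊗[k] (B2 ⊗[k] (B1 ⊗[k] B1))) →ₗ[k] (B2 ⊗[k] (B1 ⊗[k] (B2 ⊗[k] B1))))
      ∘ₗ ((skp (skp delta1)) : (B2 ⊗[k] (B2 ⊗[k] B1)) →ₗ[k] (B2 ⊗[k] (B2 ⊗[k] (B1 ⊗[k] B1))))
      ∘ₗ ((split2 delta2) : (B2 ⊗[k] B1) →ₗ[k] (B2 ⊗[k] (B2 ⊗[k] B1)))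

/-- `φ₁₂ = (m₂ ⊗ m₁) ∘ (id ⊗ τ ⊗ id) ∘ (ν_l ⊗ ν_r)` -/
noncomputable def mpPhi12 (m1 : (B1 ⊗[k] B1) →ₗ[k] B1) (m2 : (B2 ⊗[k] B2) →ₗ[k] B2)
    (coactL : B1 →ₗ[k] (B2 ⊗[k] B1)) (coactR : B2 →ₗ[k] (B2 ⊗[k] B1)) :
    (B1 ⊗[k] B2) →ₗ[k] (B2 ⊗[k] B1) :=
  ((skp m1) : (B2 ⊗[k] (B1 ⊗[k] B1)) →ₗ[k] (B2 ⊗[k] B1))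
      ∘ₗ ((merge2 m2) : (B2 ⊗[k] (B2 ⊗[k] (B1 ⊗[k] B1))) →ₗ[k] (B2 ⊗[k] (B1 ⊗[k] B1)))
      ∘ₗ ((skp swap2) : (B2 ⊗[k] (B1 ⊗[k] (B2 ⊗[k] B1))) →ₗ[k] (B2 ⊗[k] (B2 ⊗[k] (B1 ⊗[k] B1))))
      ∘ₗ ((skp (skp coactR)) : (B2 ⊗[k] (B1 ⊗[k] B2)) →ₗ[k] (B2 ⊗[k] (B1 ⊗[k] (B2 ⊗[k] B1))))
      ∘ₗ ((split2 coactL) : (B1 ⊗[k] B2) →ₗ[k] (B2 ⊗[k] (B1 ⊗[k] B2)))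


variable (hd : HopfDatum k B1 B2)

/-- the morphism `φ₂₁` canonically associated with a Hopf datum -/
noncomputable def hdPhi21 : (B2 ⊗[k] B1) →ₗ[k] (B1 ⊗[k] B2) :=
  mpPhi21 hd.delta1 hd.delta2 hd.actL hd.actR

/-- the morphism `φ₁₂` canonically associated with a Hopf datum -/
noncomputable def hdPhi12 : (B1 ⊗[k] B2) →ₗ[k] (B2 ⊗[k] B1) :=
  mpPhi12 hd.m1 hd.m2 hd.coactL hd.coactR

/-- the multiplication on `B₁ ⊗ B₂` associated with a Hopf datum (Proposition 2.6) -/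
noncomputable def hdMul : ((B1 ⊗[k] B2) ⊗[k] (B1 ⊗[k] B2)) →ₗ[k] (B1 ⊗[k] B2) :=
  crossMul hd.m1 hd.m2 (hdPhi21 hd)

/-- the unit on `B₁ ⊗ B₂` associated with a Hopf datum -/
noncomputable def hdUnit : k →ₗ[k] (B1 ⊗[k] B2) := crossUnit hd.eta1 hd.eta2

/-- the comultiplication on `B₁ ⊗ B₂` associated with a Hopf datum (Proposition 2.6) -/
noncomputable def hdComul : (B1 ⊗[k] B2) →ₗ[k] ((B1 ⊗[k] B2) ⊗[k] (B1 ⊗[k] B2)) :=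
  crossComul hd.delta1 hd.delta2 (hdPhi12 hd)

/-- the counit on `B₁ ⊗ B₂` associated with a Hopf datum -/
noncomputable def hdCounit : (B1 ⊗[k] B2) →ₗ[k] k := crossCounit hd.eps1 hd.eps2

/-- the idempotent `π = (η₁ ∘ ε₁) ⊗ id ⊗ id ⊗ (η₂ ∘ ε₂)` on `B₁ ⊗ B₂ ⊗ B₁ ⊗ B₂` -/
noncomputable def piMap : (B1 ⊗[k] (B2 ⊗[k] (B1 ⊗[k] B2))) →ₗ[k]
    (B1 ⊗[k] (B2 ⊗[k] (B1 ⊗[k] B2))) :=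
  TensorProduct.map (hd.eta1 ∘ₗ hd.eps1)
    (TensorProduct.map LinearMap.id (TensorProduct.map LinearMap.id (hd.eta2 ∘ₗ hd.eps2)))

/-- the recursion operator `Φ` of Definition 2.10 / eq. (2.11) of Bespalov-Drabant,
"Cross Product Bialgebras I", associated with a Hopf datum -/
noncomputable def Phi (f : (B1 ⊗[k] (B2 ⊗[k] (B1 ⊗[k] B2))) →ₗ[k]
    (B1 ⊗[k] (B2 ⊗[k] (B1 ⊗[k] B2)))) :
    (B1 ⊗[k] (B2 ⊗[k] (B1 ⊗[k] B2))) →ₗ[k] (B1 ⊗[k] (B2 ⊗[k] (B1 ⊗[k] B2))) :=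
  ((skp (skp (merge2 hd.m1))) : (B1 ⊗[k] (B2 ⊗[k] (B1 ⊗[k] (B1 ⊗[k] B2)))) →ₗ[k] (B1 ⊗[k] (B2 ⊗[k] (B1 ⊗[k] B2))))
      ∘ₗ ((skp (merge2 hd.m2)) : (B1 ⊗[k] (B2 ⊗[k] (B2 ⊗[k] (B1 ⊗[k] (B1 ⊗[k] B2))))) →ₗ[k] (B1 ⊗[k] (B2 ⊗[k] (B1 ⊗[k] (B1 ⊗[k] B2)))))
      ∘ₗ ((skp (skp (skp (skp (merge2 hd.m1))))) : (B1 ⊗[k] (B2 ⊗[k] (B2 ⊗[k] (B1 ⊗[k] (B1 ⊗[k] (B1 ⊗[k] B2)))))) →ₗ[k] (B1 ⊗[k] (B2 ⊗[k] (B2 ⊗[k] (B1 ⊗[k] (B1 ⊗[k] B2))))))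
      ∘ₗ ((skp (skp swap2)) : (B1 ⊗[k] (B2 ⊗[k] (B1 ⊗[k] (B2 ⊗[k] (B1 ⊗[k] (B1 ⊗[k] B2)))))) →ₗ[k] (B1 ⊗[k] (B2 ⊗[k] (B2 ⊗[k] (B1 ⊗[k] (B1 ⊗[k] (B1 ⊗[k] B2)))))))
      ∘ₗ ((skp (merge2 hd.m2)) : (B1 ⊗[k] (B2 ⊗[k] (B2 ⊗[k] (B1 ⊗[k] (B2 ⊗[k] (B1 ⊗[k] (B1 ⊗[k] B2))))))) →ₗ[k] (B1 ⊗[k] (B2 ⊗[k] (B1 ⊗[k] (B2 ⊗[k] (B1 ⊗[k] (B1 ⊗[k] B2)))))))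
      ∘ₗ ((skp (skp (skp (skp (skp (skp (merge2 hd.actL))))))) : (B1 ⊗[k] (B2 ⊗[k] (B2 ⊗[k] (B1 ⊗[k] (B2 ⊗[k] (B1 ⊗[k] (B2 ⊗[k] (B1 ⊗[k] B2)))))))) →ₗ[k] (B1 ⊗[k] (B2 ⊗[k] (B2 ⊗[k] (B1 ⊗[k] (B2 ⊗[k] (B1 ⊗[k] (B1 ⊗[k] B2))))))))
      ∘ₗ ((skp (skp (skp (skp swap2)))) : (B1 ⊗[k] (B2 ⊗[k] (B2 ⊗[k] (B1 ⊗[k] (B1 ⊗[k] (B2 ⊗[k] (B2 ⊗[k] (B1 ⊗[k] B2)))))))) →ₗ[k] (B1 ⊗[k] (B2 ⊗[k] (B2 ⊗[k] (B1 ⊗[k] (B2 ⊗[k] (B1 ⊗[k] (B2 ⊗[k] (B1 ⊗[k] B2)))))))))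
      ∘ₗ ((skp (skp swap2)) : (B1 ⊗[k] (B2 ⊗[k] (B1 ⊗[k] (B2 ⊗[k] (B1 ⊗[k] (B2 ⊗[k] (B2 ⊗[k] (B1 ⊗[k] B2)))))))) →ₗ[k] (B1 ⊗[k] (B2 ⊗[k] (B2 ⊗[k] (B1 ⊗[k] (B1 ⊗[k] (B2 ⊗[k] (B2 ⊗[k] (B1 ⊗[k] B2)))))))))
      ∘ₗ ((skp (merge2 hd.actR)) : (B1 ⊗[k] (B2 ⊗[k] (B1 ⊗[k] (B1 ⊗[k] (B2 ⊗[k] (B1 ⊗[k] (B2 ⊗[k] (B2 ⊗[k] (B1 ⊗[k] B2))))))))) →ₗ[k] (B1 ⊗[k] (B2 ⊗[k] (B1 ⊗[k] (B2 ⊗[k] (B1 ⊗[k] (B2 ⊗[k] (B2 ⊗[k] (B1 ⊗[k] B2)))))))))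
      ∘ₗ ((skp (skp (skp (skp (skp (skp (skp (skp (skp hd.m2))))))))) : (B1 ⊗[k] (B2 ⊗[k] (B1 ⊗[k] (B1 ⊗[k] (B2 ⊗[k] (B1 ⊗[k] (B2 ⊗[k] (B2 ⊗[k] (B1 ⊗[k] (B2 ⊗[k] B2)))))))))) →ₗ[k] (B1 ⊗[k] (B2 ⊗[k] (B1 ⊗[k] (B1 ⊗[k] (B2 ⊗[k] (B1 ⊗[k] (B2 ⊗[k] (B2 ⊗[k] (B1 ⊗[k] B2))))))))))
      ∘ₗ ((skp (skp (skp (skp (skp (skp swap2)))))) : (B1 ⊗[k] (B2 ⊗[k] (B1 ⊗[k] (B1 ⊗[k] (B2 ⊗[k] (B1 ⊗[k] (B2 ⊗[k] (B2 ⊗[k] (B1 ⊗[k] (B2 ⊗[k] B2)))))))))) →ₗ[k] (B1 ⊗[k] (B2 ⊗[k] (B1 ⊗[k] (B1 ⊗[k] (B2 ⊗[k] (B1 ⊗[k] (B2 ⊗[k] (B2 ⊗[k] (B1 ⊗[k] (B2 ⊗[k] B2)))))))))))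
      ∘ₗ ((skp (skp swap2)) : (B1 ⊗[k] (B2 ⊗[k] (B1 ⊗[k] (B1 ⊗[k] (B2 ⊗[k] (B1 ⊗[k] (B2 ⊗[k] (B2 ⊗[k] (B1 ⊗[k] (B2 ⊗[k] B2)))))))))) →ₗ[k] (B1 ⊗[k] (B2 ⊗[k] (B1 ⊗[k] (B1 ⊗[k] (B2 ⊗[k] (B1 ⊗[k] (B2 ⊗[k] (B2 ⊗[k] (B1 ⊗[k] (B2 ⊗[k] B2)))))))))))
      ∘ₗ ((merge2 hd.m1) : (B1 ⊗[k] (B1 ⊗[k] (B2 ⊗[k] (B1 ⊗[k] (B1 ⊗[k] (B2 ⊗[k] (B1 ⊗[k] (B2 ⊗[k] (B2 ⊗[k] (B1 ⊗[k] (B2 ⊗[k] B2))))))))))) →ₗ[k] (B1 ⊗[k] (B2 ⊗[k] (B1 ⊗[k] (B1 ⊗[k] (B2 ⊗[k] (B1 ⊗[k] (B2 ⊗[k] (B2 ⊗[k] (B1 ⊗[k] (B2 ⊗[k] B2)))))))))))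
      ∘ₗ ((skp (skp (skp (skp (skp (skp (skp (skp (skp (skp (merge2 hd.actR))))))))))) : (B1 ⊗[k] (B1 ⊗[k] (B2 ⊗[k] (B1 ⊗[k] (B1 ⊗[k] (B2 ⊗[k] (B1 ⊗[k] (B2 ⊗[k] (B2 ⊗[k] (B1 ⊗[k] (B2 ⊗[k] (B1 ⊗[k] B2)))))))))))) →ₗ[k] (B1 ⊗[k] (B1 ⊗[k] (B2 ⊗[k] (B1 ⊗[k] (B1 ⊗[k] (B2 ⊗[k] (B1 ⊗[k] (B2 ⊗[k] (B2 ⊗[k] (B1 ⊗[k] (B2 ⊗[k] B2))))))))))))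
      ∘ₗ ((skp (skp (skp (skp (skp (skp (skp (skp (split2 hd.coactR))))))))) : (B1 ⊗[k] (B1 ⊗[k] (B2 ⊗[k] (B1 ⊗[k] (B1 ⊗[k] (B2 ⊗[k] (B1 ⊗[k] (B2 ⊗[k] (B2 ⊗[k] (B2 ⊗[k] (B1 ⊗[k] B2))))))))))) →ₗ[k] (B1 ⊗[k] (B1 ⊗[k] (B2 ⊗[k] (B1 ⊗[k] (B1 ⊗[k] (B2 ⊗[k] (B1 ⊗[k] (B2 ⊗[k] (B2 ⊗[k] (B1 ⊗[k] (B2 ⊗[k] (B1 ⊗[k] B2)))))))))))))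
      ∘ₗ ((skp (skp (split2 hd.coactL))) : (B1 ⊗[k] (B1 ⊗[k] (B1 ⊗[k] (B1 ⊗[k] (B2 ⊗[k] (B1 ⊗[k] (B2 ⊗[k] (B2 ⊗[k] (B2 ⊗[k] (B1 ⊗[k] B2)))))))))) →ₗ[k] (B1 ⊗[k] (B1 ⊗[k] (B2 ⊗[k] (B1 ⊗[k] (B1 ⊗[k] (B2 ⊗[k] (B1 ⊗[k] (B2 ⊗[k] (B2 ⊗[k] (B2 ⊗[k] (B1 ⊗[k] B2))))))))))))
      ∘ₗ ((skp (merge2 hd.actL)) : (B1 ⊗[k] (B2 ⊗[k] (B1 ⊗[k] (B1 ⊗[k] (B1 ⊗[k] (B2 ⊗[k] (B1 ⊗[k] (B2 ⊗[k] (B2 ⊗[k] (B2 ⊗[k] (B1 ⊗[k] B2))))))))))) →ₗ[k] (B1 ⊗[k] (B1 ⊗[k] (B1 ⊗[k] (B1 ⊗[k] (B2 ⊗[k] (B1 ⊗[k] (B2 ⊗[k] (B2 ⊗[k] (B2 ⊗[k] (B1 ⊗[k] B2)))))))))))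
      ∘ₗ ((skp (skp (skp (skp (skp (skp (skp (skp swap2)))))))) : (B1 ⊗[k] (B2 ⊗[k] (B1 ⊗[k] (B1 ⊗[k] (B1 ⊗[k] (B2 ⊗[k] (B1 ⊗[k] (B2 ⊗[k] (B2 ⊗[k] (B2 ⊗[k] (B1 ⊗[k] B2))))))))))) →ₗ[k] (B1 ⊗[k] (B2 ⊗[k] (B1 ⊗[k] (B1 ⊗[k] (B1 ⊗[k] (B2 ⊗[k] (B1 ⊗[k] (B2 ⊗[k] (B2 ⊗[k] (B2 ⊗[k] (B1 ⊗[k] B2))))))))))))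
      ∘ₗ ((skp (skp (skp (skp (apply4 f))))) : (B1 ⊗[k] (B2 ⊗[k] (B1 ⊗[k] (B1 ⊗[k] (B1 ⊗[k] (B2 ⊗[k] (B1 ⊗[k] (B2 ⊗[k] (B2 ⊗[k] (B2 ⊗[k] (B1 ⊗[k] B2))))))))))) →ₗ[k] (B1 ⊗[k] (B2 ⊗[k] (B1 ⊗[k] (B1 ⊗[k] (B1 ⊗[k] (B2 ⊗[k] (B1 ⊗[k] (B2 ⊗[k] (B2 ⊗[k] (B2 ⊗[k] (B1 ⊗[k] B2))))))))))))
      ∘ₗ ((skp (skp swap2)) : (B1 ⊗[k] (B2 ⊗[k] (B1 ⊗[k] (B1 ⊗[k] (B1 ⊗[k] (B2 ⊗[k] (B1 ⊗[k] (B2 ⊗[k] (B2 ⊗[k] (B2 ⊗[k] (B1 ⊗[k] B2))))))))))) →ₗ[k] (B1 ⊗[k] (B2 ⊗[k] (B1 ⊗[k] (B1 ⊗[k] (B1 ⊗[k] (B2 ⊗[k] (B1 ⊗[k] (B2 ⊗[k] (B2 ⊗[k] (B2 ⊗[k] (B1 ⊗[k] B2))))))))))))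
      ∘ₗ ((skp (skp (skp (skp (skp (skp (skp (skp (skp (split2 hd.coactR)))))))))) : (B1 ⊗[k] (B2 ⊗[k] (B1 ⊗[k] (B1 ⊗[k] (B1 ⊗[k] (B2 ⊗[k] (B1 ⊗[k] (B2 ⊗[k] (B2 ⊗[k] (B2 ⊗[k] B2)))))))))) →ₗ[k] (B1 ⊗[k] (B2 ⊗[k] (B1 ⊗[k] (B1 ⊗[k] (B1 ⊗[k] (B2 ⊗[k] (B1 ⊗[k] (B2 ⊗[k] (B2 ⊗[k] (B2 ⊗[k] (B1 ⊗[k] B2))))))))))))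
      ∘ₗ ((skp (skp (skp (skp (skp (skp (skp (skp (merge2 hd.actR))))))))) : (B1 ⊗[k] (B2 ⊗[k] (B1 ⊗[k] (B1 ⊗[k] (B1 ⊗[k] (B2 ⊗[k] (B1 ⊗[k] (B2 ⊗[k] (B2 ⊗[k] (B1 ⊗[k] (B2 ⊗[k] B2))))))))))) →ₗ[k] (B1 ⊗[k] (B2 ⊗[k] (B1 ⊗[k] (B1 ⊗[k] (B1 ⊗[k] (B2 ⊗[k] (B1 ⊗[k] (B2 ⊗[k] (B2 ⊗[k] (B2 ⊗[k] B2)))))))))))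
      ∘ₗ ((skp (skp (skp (merge2 hd.actL)))) : (B1 ⊗[k] (B2 ⊗[k] (B1 ⊗[k] (B2 ⊗[k] (B1 ⊗[k] (B1 ⊗[k] (B2 ⊗[k] (B1 ⊗[k] (B2 ⊗[k] (B2 ⊗[k] (B1 ⊗[k] (B2 ⊗[k] B2)))))))))))) →ₗ[k] (B1 ⊗[k] (B2 ⊗[k] (B1 ⊗[k] (B1 ⊗[k] (B1 ⊗[k] (B2 ⊗[k] (B1 ⊗[k] (B2 ⊗[k] (B2 ⊗[k] (B1 ⊗[k] (B2 ⊗[k] B2))))))))))))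
      ∘ₗ ((skp (split2 hd.coactL)) : (B1 ⊗[k] (B1 ⊗[k] (B2 ⊗[k] (B1 ⊗[k] (B1 ⊗[k] (B2 ⊗[k] (B1 ⊗[k] (B2 ⊗[k] (B2 ⊗[k] (B1 ⊗[k] (B2 ⊗[k] B2))))))))))) →ₗ[k] (B1 ⊗[k] (B2 ⊗[k] (B1 ⊗[k] (B2 ⊗[k] (B1 ⊗[k] (B1 ⊗[k] (B2 ⊗[k] (B1 ⊗[k] (B2 ⊗[k] (B2 ⊗[k] (B1 ⊗[k] (B2 ⊗[k] B2)))))))))))))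
      ∘ₗ ((skp (skp (skp (skp (skp (skp (skp (skp (skp (skp hd.delta2)))))))))) : (B1 ⊗[k] (B1 ⊗[k] (B2 ⊗[k] (B1 ⊗[k] (B1 ⊗[k] (B2 ⊗[k] (B1 ⊗[k] (B2 ⊗[k] (B2 ⊗[k] (B1 ⊗[k] B2)))))))))) →ₗ[k] (B1 ⊗[k] (B1 ⊗[k] (B2 ⊗[k] (B1 ⊗[k] (B1 ⊗[k] (B2 ⊗[k] (B1 ⊗[k] (B2 ⊗[k] (B2 ⊗[k] (B1 ⊗[k] (B2 ⊗[k] B2))))))))))))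
      ∘ₗ ((skp (skp (skp (skp (skp (skp (skp swap2))))))) : (B1 ⊗[k] (B1 ⊗[k] (B2 ⊗[k] (B1 ⊗[k] (B1 ⊗[k] (B2 ⊗[k] (B1 ⊗[k] (B2 ⊗[k] (B2 ⊗[k] (B1 ⊗[k] B2)))))))))) →ₗ[k] (B1 ⊗[k] (B1 ⊗[k] (B2 ⊗[k] (B1 ⊗[k] (B1 ⊗[k] (B2 ⊗[k] (B1 ⊗[k] (B2 ⊗[k] (B2 ⊗[k] (B1 ⊗[k] B2)))))))))))
      ∘ₗ ((skp (skp (skp swap2))) : (B1 ⊗[k] (B1 ⊗[k] (B2 ⊗[k] (B1 ⊗[k] (B1 ⊗[k] (B2 ⊗[k] (B1 ⊗[k] (B2 ⊗[k] (B2 ⊗[k] (B1 ⊗[k] B2)))))))))) →ₗ[k] (B1 ⊗[k] (B1 ⊗[k] (B2 ⊗[k] (B1 ⊗[k] (B1 ⊗[k] (B2 ⊗[k] (B1 ⊗[k] (B2 ⊗[k] (B2 ⊗[k] (B1 ⊗[k] B2)))))))))))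
      ∘ₗ ((split2 hd.delta1) : (B1 ⊗[k] (B2 ⊗[k] (B1 ⊗[k] (B1 ⊗[k] (B2 ⊗[k] (B1 ⊗[k] (B2 ⊗[k] (B2 ⊗[k] (B1 ⊗[k] B2))))))))) →ₗ[k] (B1 ⊗[k] (B1 ⊗[k] (B2 ⊗[k] (B1 ⊗[k] (B1 ⊗[k] (B2 ⊗[k] (B1 ⊗[k] (B2 ⊗[k] (B2 ⊗[k] (B1 ⊗[k] B2)))))))))))
      ∘ₗ ((skp (skp (skp (skp (skp (skp (skp (split2 hd.coactL)))))))) : (B1 ⊗[k] (B2 ⊗[k] (B1 ⊗[k] (B1 ⊗[k] (B2 ⊗[k] (B1 ⊗[k] (B2 ⊗[k] (B1 ⊗[k] B2)))))))) →ₗ[k] (B1 ⊗[k] (B2 ⊗[k] (B1 ⊗[k] (B1 ⊗[k] (B2 ⊗[k] (B1 ⊗[k] (B2 ⊗[k] (B2 ⊗[k] (B1 ⊗[k] B2))))))))))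
      ∘ₗ ((skp (skp (skp (skp (skp swap2))))) : (B1 ⊗[k] (B2 ⊗[k] (B1 ⊗[k] (B1 ⊗[k] (B2 ⊗[k] (B2 ⊗[k] (B1 ⊗[k] (B1 ⊗[k] B2)))))))) →ₗ[k] (B1 ⊗[k] (B2 ⊗[k] (B1 ⊗[k] (B1 ⊗[k] (B2 ⊗[k] (B1 ⊗[k] (B2 ⊗[k] (B1 ⊗[k] B2)))))))))
      ∘ₗ ((skp (skp (skp swap2))) : (B1 ⊗[k] (B2 ⊗[k] (B1 ⊗[k] (B2 ⊗[k] (B1 ⊗[k] (B2 ⊗[k] (B1 ⊗[k] (B1 ⊗[k] B2)))))))) →ₗ[k] (B1 ⊗[k] (B2 ⊗[k] (B1 ⊗[k] (B1 ⊗[k] (B2 ⊗[k] (B2 ⊗[k] (B1 ⊗[k] (B1 ⊗[k] B2)))))))))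
      ∘ₗ ((skp (split2 hd.coactR)) : (B1 ⊗[k] (B2 ⊗[k] (B2 ⊗[k] (B1 ⊗[k] (B2 ⊗[k] (B1 ⊗[k] (B1 ⊗[k] B2))))))) →ₗ[k] (B1 ⊗[k] (B2 ⊗[k] (B1 ⊗[k] (B2 ⊗[k] (B1 ⊗[k] (B2 ⊗[k] (B1 ⊗[k] (B1 ⊗[k] B2)))))))))
      ∘ₗ ((skp (skp (skp (skp (skp (split2 hd.delta1)))))) : (B1 ⊗[k] (B2 ⊗[k] (B2 ⊗[k] (B1 ⊗[k] (B2 ⊗[k] (B1 ⊗[k] B2)))))) →ₗ[k] (B1 ⊗[k] (B2 ⊗[k] (B2 ⊗[k] (B1 ⊗[k] (B2 ⊗[k] (B1 ⊗[k] (B1 ⊗[k] B2))))))))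
      ∘ₗ ((skp (skp (skp swap2))) : (B1 ⊗[k] (B2 ⊗[k] (B2 ⊗[k] (B2 ⊗[k] (B1 ⊗[k] (B1 ⊗[k] B2)))))) →ₗ[k] (B1 ⊗[k] (B2 ⊗[k] (B2 ⊗[k] (B1 ⊗[k] (B2 ⊗[k] (B1 ⊗[k] B2)))))))
      ∘ₗ ((skp (split2 hd.delta2)) : (B1 ⊗[k] (B2 ⊗[k] (B2 ⊗[k] (B1 ⊗[k] (B1 ⊗[k] B2))))) →ₗ[k] (B1 ⊗[k] (B2 ⊗[k] (B2 ⊗[k] (B2 ⊗[k] (B1 ⊗[k] (B1 ⊗[k] B2)))))))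
      ∘ₗ ((skp (skp (skp (split2 hd.delta1)))) : (B1 ⊗[k] (B2 ⊗[k] (B2 ⊗[k] (B1 ⊗[k] B2)))) →ₗ[k] (B1 ⊗[k] (B2 ⊗[k] (B2 ⊗[k] (B1 ⊗[k] (B1 ⊗[k] B2))))))
      ∘ₗ ((skp (split2 hd.delta2)) : (B1 ⊗[k] (B2 ⊗[k] (B1 ⊗[k] B2))) →ₗ[k] (B1 ⊗[k] (B2 ⊗[k] (B2 ⊗[k] (B1 ⊗[k] B2)))))

end Derived

end CPB

namespace CPB

variable {k : Type*} [CommRing k] {B1 B2 : Type*}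
  [AddCommMonoid B1] [Module k B1] [AddCommMonoid B2] [Module k B2]

/-!
Overview of the proof.

Both sides are linear, so it suffices to evaluate them on `x ⊗ y ⊗ z ⊗ w`; the first application
of `π` turns this into a scalar multiple of `1 ⊗ b ⊗ a ⊗ 1`, with `1` the unit of the relevant
tensor factor. Write `Δ₂ b = b₁ ⊗ b₂`, `Δ₁ a = a₁ ⊗ a₂`, `ν_r b = b₍₀₎ ⊗ b₍₁₎`,
`ν_l a = a₍₋₁₎ ⊗ a₍₀₎`, and follow the strands through the thirty-seven layers of `Φ(f)`, which are
cut into four blocks.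

* `phiA`, layers 1 to 5. Only comultiplications and one flip occur, and the outcome is
  `1 ⊗ b₁ ⊗ b₂ ⊗ a₁ ⊗ b₃ ⊗ a₂ ⊗ a₃ ⊗ 1`.
* `phiB`, layers 6 to 9. The outer copies `b₁` and `a₃` are hit by the coactions. Two flips
  then move the strands into the order
  `1 ⊗ b₁₍₀₎ ⊗ b₁₍₁₎ ⊗ a₁ ⊗ b₂ ⊗ a₂ ⊗ b₃ ⊗ a₃₍₋₁₎ ⊗ a₃₍₀₎ ⊗ 1`.
* `phiC`, layers 10 to 19. The two outer units get comultiplied and coacted upon; because units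
  are grouplike and coinvariant nothing but further units is produced. On the inner strands one
  forms `X = b₁₍₀₎ ▷ a₁` and `Y = b₃ ◁ a₃₍₀₎`, and finally `f` is evaluated at the four strands
  `b₁₍₁₎ ⊗ b₂ ⊗ a₂ ⊗ a₃₍₋₁₎`.
* `phiD`, layers 20 to 37. For a decomposable value `f₁ ⊗ f₂ ⊗ f₃ ⊗ f₄` the result is
  `X ⊗ (1 ◁ f₁) f₂ ⊗ f₃ (f₄ ▷ 1) ⊗ Y`, and since `1 ◁ f₁ = ε₁(f₁) 1` and `f₄ ▷ 1 = ε₂(f₄) 1`, the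
  second application of `π` returns `ε₁(X) ε₂(Y) π(f₁ ⊗ f₂ ⊗ f₃ ⊗ f₄)`.

It remains to collapse the Sweedler sums. Counit compatibility of the actions gives
`ε₁(X) = ε₂(b₁₍₀₎) ε₁(a₁)` and `ε₂(Y) = ε₂(b₃) ε₁(a₃₍₀₎)`. Next, `ε₂(b₁₍₀₎) b₁₍₁₎ = ε₂(b₁) 1`
together with `a₃₍₋₁₎ ε₁(a₃₍₀₎) = ε₁(a₃) 1` shows that `f` gets evaluated at `1 ⊗ b₂ ⊗ a₂ ⊗ 1`,
and what is left of the outer copies disappears by counitality, so that we obtain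
`π (f (1 ⊗ b ⊗ a ⊗ 1))`, as required.

The grouplike property of the units is not among the axioms listed in `HopfDatum`; it is a
consequence. Evaluating coassociativity of `ν_r` at `1`, where `ν_r(1) = 1 ⊗ 1`, yields
`1 ⊗ Δ₁(1) = 1 ⊗ 1 ⊗ 1`, and applying `ε₂` to the leftmost factor isolates `Δ₁(1)`. The mirror
image of this argument, using `ν_l` and `ε₁`, treats `Δ₂(1)`.
-/

section Aux
variable {A B C D R R' : Type*}
  [AddCommMonoid A] [Module k A] [AddCommMonoid B] [Module k B]
  [AddCommMonoid C] [Module k C] [AddCommMonoid D] [Module k D]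
  [AddCommMonoid R'] [Module k R'] [AddCommMonoid R] [Module k R]

/-- Scalars leave the left leg of a pure tensor; oriented so that `simp` never loops. -/
theorem smul_tl (c : k) (a : A) (b : B) : (c • a) ⊗ₜ[k] b = c • (a ⊗ₜ[k] b) :=
  (TensorProduct.smul_tmul' c a b).symm

/-- Skipping past one strand. -/
theorem skp_tmul (g : R →ₗ[k] R') (a : A) (r : R) : skp g (a ⊗ₜ[k] r) = a ⊗ₜ[k] g r := rfl

theorem merge2_tmul (m : (A ⊗[k] B) →ₗ[k] C) (a : A) (b : B) (r : R) :
    merge2 m (a ⊗ₜ[k] (b ⊗ₜ[k] r)) = m (a ⊗ₜ[k] b) ⊗ₜ[k] r := rfl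

theorem swap2_tmul (a : A) (b : B) (r : R) :
    swap2 (a ⊗ₜ[k] (b ⊗ₜ[k] r)) = b ⊗ₜ[k] (a ⊗ₜ[k] r) := rfl

/-- reassociation with a fixed tail -/
noncomputable def tl (r : R) : (C ⊗[k] D) →ₗ[k] (C ⊗[k] (D ⊗[k] R)) :=
  (TensorProduct.assoc k C D R).toLinearMap ∘ₗ (TensorProduct.mk k (C ⊗[k] D) R).flip r

theorem tl_tmul (r : R) (c : C) (d : D) : tl r (c ⊗ₜ[k] d) = c ⊗ₜ[k] (d ⊗ₜ[k] r) := rfl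

theorem split2_tmul (d : A →ₗ[k] (C ⊗[k] D)) (a : A) (r : R) :
    split2 d (a ⊗ₜ[k] r) = tl r (d a) := rfl

/-- put a four-fold tensor in front of a fixed tail -/
noncomputable def tl4 (r : R) : (B1 ⊗[k] (B2 ⊗[k] (B1 ⊗[k] B2))) →ₗ[k]
      (B1 ⊗[k] (B2 ⊗[k] (B1 ⊗[k] (B2 ⊗[k] R)))) :=
  ((TensorProduct.assoc k B1 (B2 ⊗[k] (B1 ⊗[k] B2)) R) ≪≫ₗ
      TensorProduct.congr (LinearEquiv.refl k B1)
        ((TensorProduct.assoc k B2 (B1 ⊗[k] B2) R) ≪≫ₗ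
          TensorProduct.congr (LinearEquiv.refl k B2) (TensorProduct.assoc k B1 B2 R))).toLinearMap
    ∘ₗ (TensorProduct.mk k (B1 ⊗[k] (B2 ⊗[k] (B1 ⊗[k] B2))) R).flip r

theorem tl4_tmul (r : R) (a : B1) (b : B2) (c : B1) (d : B2) :
    tl4 r (a ⊗ₜ[k] (b ⊗ₜ[k] (c ⊗ₜ[k] d))) = a ⊗ₜ[k] (b ⊗ₜ[k] (c ⊗ₜ[k] (d ⊗ₜ[k] r))) := rfl

/-- Feeding four pure strands to an endomorphism while carrying the remaining tail along unchanged. -/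
theorem apply4_tmul
    (f : (B1 ⊗[k] (B2 ⊗[k] (B1 ⊗[k] B2))) →ₗ[k] (B1 ⊗[k] (B2 ⊗[k] (B1 ⊗[k] B2))))
    (r : R) (a : B1) (b : B2) (c : B1) (d : B2) :
    apply4 f (a ⊗ₜ[k] (b ⊗ₜ[k] (c ⊗ₜ[k] (d ⊗ₜ[k] r)))) =
      tl4 r (f (a ⊗ₜ[k] (b ⊗ₜ[k] (c ⊗ₜ[k] d)))) := rfl

end Aux

section Consequences
variable (hd : HopfDatum k B1 B2)

/-- By linearity every value of the unit map is proportional to the identity element. -/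
theorem eta1_r (r : k) : hd.eta1 r = r • hd.eta1 1 := by
  rw [← map_smul, smul_eq_mul, mul_one]

theorem eta2_r (r : k) : hd.eta2 r = r • hd.eta2 1 := by
  rw [← map_smul, smul_eq_mul, mul_one]

theorem eps1_one : hd.eps1 (hd.eta1 1) = 1 := LinearMap.congr_fun hd.epseta1 1
theorem eps2_one : hd.eps2 (hd.eta2 1) = 1 := LinearMap.congr_fun hd.epseta2 1

theorem coactL_one : hd.coactL (hd.eta1 1) = hd.eta2 1 ⊗ₜ[k] hd.eta1 1 :=
  LinearMap.congr_fun hd.coactL_eta1 1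

theorem coactR_one : hd.coactR (hd.eta2 1) = hd.eta2 1 ⊗ₜ[k] hd.eta1 1 :=
  LinearMap.congr_fun hd.coactR_eta2 1

theorem actL_one (x : B1) : hd.actL (hd.eta2 1 ⊗ₜ[k] x) = x :=
  LinearMap.congr_fun hd.actL_unit x

theorem actR_one (x : B2) : hd.actR (x ⊗ₜ[k] hd.eta1 1) = x :=
  LinearMap.congr_fun hd.actR_unit x

/-- The unit absorbs the right action: only a counit of the acting element survives. -/
theorem one_actR (x : B1) : hd.actR (hd.eta2 1 ⊗ₜ[k] x) = hd.eps1 x • hd.eta2 1 :=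
  (LinearMap.congr_fun hd.actR_eta2 x).trans (eta2_r hd _)

theorem one_actL (x : B2) : hd.actL (x ⊗ₜ[k] hd.eta1 1) = hd.eps2 x • hd.eta1 1 :=
  (LinearMap.congr_fun hd.actL_eta1 x).trans (eta1_r hd _)

/-- Applying the counit after acting decouples both arguments. -/
theorem eps2_actR' (x : B2) (y : B1) :
    hd.eps2 (hd.actR (x ⊗ₜ[k] y)) = hd.eps2 x * hd.eps1 y :=
  LinearMap.congr_fun hd.eps2_actR (x ⊗ₜ y)

theorem eps1_actL' (x : B2) (y : B1) :
    hd.eps1 (hd.actL (x ⊗ₜ[k] y)) = hd.eps2 x * hd.eps1 y :=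
  LinearMap.congr_fun hd.eps1_actL (x ⊗ₜ y)

theorem m1_one_left (x : B1) : hd.m1 (hd.eta1 1 ⊗ₜ[k] x) = x :=
  LinearMap.congr_fun hd.alg1.one_mul x
theorem m1_one_right (x : B1) : hd.m1 (x ⊗ₜ[k] hd.eta1 1) = x :=
  LinearMap.congr_fun hd.alg1.mul_one x
theorem m2_one_left (x : B2) : hd.m2 (hd.eta2 1 ⊗ₜ[k] x) = x :=
  LinearMap.congr_fun hd.alg2.one_mul x
theorem m2_one_right (x : B2) : hd.m2 (x ⊗ₜ[k] hd.eta2 1) = x :=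
  LinearMap.congr_fun hd.alg2.mul_one x

/-- `Δ₁ ∘ η₁ = η₁ ⊗ η₁` follows from `ν_r` being a coaction with `ν_r ∘ η₂ = η₂ ⊗ η₁`. -/
theorem delta1_one : hd.delta1 (hd.eta1 1) = hd.eta1 1 ⊗ₜ[k] hd.eta1 1 := by
  have h := LinearMap.congr_fun hd.coactR_coact (hd.eta2 1)
  simp only [LinearMap.comp_apply, coactR_one, split2_tmul, skp_tmul, tl_tmul] at h
  have h2 := congrArg (TensorProduct.lid k (B1 ⊗[k] B1) ∘
    TensorProduct.map hd.eps2 LinearMap.id) h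
  simpa [eps2_one] using h2.symm

/-- Mirror image of the previous fact, now obtained from the left coaction. -/
theorem delta2_one : hd.delta2 (hd.eta2 1) = hd.eta2 1 ⊗ₜ[k] hd.eta2 1 := by
  have h := LinearMap.congr_fun hd.coactL_coact (hd.eta1 1)
  simp only [LinearMap.comp_apply, coactL_one, split2_tmul, skp_tmul] at h
  have h2 := congrArg (TensorProduct.rid k (B2 ⊗[k] B2) ∘
    TensorProduct.map LinearMap.id hd.eps1 ∘ (TensorProduct.assoc k B2 B2 B1).symm) h
  have h3 : TensorProduct.assoc k B2 B2 B1 (hd.delta2 (hd.eta2 1) ⊗ₜ[k] hd.eta1 1)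
    = tl (hd.eta1 1) (hd.delta2 (hd.eta2 1)) := rfl
  rw [← h3] at h2
  simpa [eps1_one] using h2

end Consequences

section Pieces

local infixr:72 "⊠" => TensorProduct k
local infixr:101 "⊙" => TensorProduct.tmul k

/-- Layers 1 to 5: iterated comultiplication of the two inner strands. -/
noncomputable def phiA (hd : HopfDatum k B1 B2) :
    (B1 ⊠ B2 ⊠ B1 ⊠ B2) →ₗ[k]
    (B1 ⊠ B2 ⊠ B2 ⊠ B1 ⊠ B2 ⊠ B1 ⊠ B1 ⊠ B2) :=
  ((skp (skp (skp (skp (skp (split2 hd.delta1)))))) :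
      B1 ⊠ B2 ⊠ B2 ⊠ B1 ⊠ B2 ⊠ B1 ⊠ B2 →ₗ[k] B1 ⊠ B2 ⊠ B2 ⊠ B1 ⊠ B2 ⊠ B1 ⊠ B1 ⊠ B2)
    ∘ₗ ((skp (skp (skp swap2))) :
      B1 ⊠ B2 ⊠ B2 ⊠ B2 ⊠ B1 ⊠ B1 ⊠ B2 →ₗ[k] B1 ⊠ B2 ⊠ B2 ⊠ B1 ⊠ B2 ⊠ B1 ⊠ B2)
    ∘ₗ ((skp (split2 hd.delta2)) :
      B1 ⊠ B2 ⊠ B2 ⊠ B1 ⊠ B1 ⊠ B2 →ₗ[k] B1 ⊠ B2 ⊠ B2 ⊠ B2 ⊠ B1 ⊠ B1 ⊠ B2)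
    ∘ₗ ((skp (skp (skp (split2 hd.delta1)))) :
      B1 ⊠ B2 ⊠ B2 ⊠ B1 ⊠ B2 →ₗ[k] B1 ⊠ B2 ⊠ B2 ⊠ B1 ⊠ B1 ⊠ B2)
    ∘ₗ ((skp (split2 hd.delta2)) :
      B1 ⊠ B2 ⊠ B1 ⊠ B2 →ₗ[k] B1 ⊠ B2 ⊠ B2 ⊠ B1 ⊠ B2)

/-- Layers 6 to 9: coactions on the outermost copies. -/
noncomputable def phiB (hd : HopfDatum k B1 B2) :
    (B1 ⊠ B2 ⊠ B2 ⊠ B1 ⊠ B2 ⊠ B1 ⊠ B1 ⊠ B2) →ₗ[k]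
    (B1 ⊠ B2 ⊠ B1 ⊠ B1 ⊠ B2 ⊠ B1 ⊠ B2 ⊠ B2 ⊠ B1 ⊠ B2) :=
  ((skp (skp (skp (skp (skp (skp (skp (split2 hd.coactL)))))))) :
      B1 ⊠ B2 ⊠ B1 ⊠ B1 ⊠ B2 ⊠ B1 ⊠ B2 ⊠ B1 ⊠ B2 →ₗ[k] B1 ⊠ B2 ⊠ B1 ⊠ B1 ⊠ B2 ⊠ B1 ⊠ B2 ⊠ B2 ⊠ B1 ⊠ B2)
    ∘ₗ ((skp (skp (skp (skp (skp swap2))))) :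
      B1 ⊠ B2 ⊠ B1 ⊠ B1 ⊠ B2 ⊠ B2 ⊠ B1 ⊠ B1 ⊠ B2 →ₗ[k] B1 ⊠ B2 ⊠ B1 ⊠ B1 ⊠ B2 ⊠ B1 ⊠ B2 ⊠ B1 ⊠ B2)
    ∘ₗ ((skp (skp (skp swap2))) :
      B1 ⊠ B2 ⊠ B1 ⊠ B2 ⊠ B1 ⊠ B2 ⊠ B1 ⊠ B1 ⊠ B2 →ₗ[k] B1 ⊠ B2 ⊠ B1 ⊠ B1 ⊠ B2 ⊠ B2 ⊠ B1 ⊠ B1 ⊠ B2)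
    ∘ₗ ((skp (split2 hd.coactR)) :
      B1 ⊠ B2 ⊠ B2 ⊠ B1 ⊠ B2 ⊠ B1 ⊠ B1 ⊠ B2 →ₗ[k] B1 ⊠ B2 ⊠ B1 ⊠ B2 ⊠ B1 ⊠ B2 ⊠ B1 ⊠ B1 ⊠ B2)

/-- Layers 10 to 19: everything up to and including the evaluation of `f`. -/
noncomputable def phiC (hd : HopfDatum k B1 B2) (f : (B1 ⊠ B2 ⊠ B1 ⊠ B2) →ₗ[k]
    (B1 ⊠ B2 ⊠ B1 ⊠ B2)) :
    (B1 ⊠ B2 ⊠ B1 ⊠ B1 ⊠ B2 ⊠ B1 ⊠ B2 ⊠ B2 ⊠ B1 ⊠ B2) →ₗ[k]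
    (B1 ⊠ B2 ⊠ B1 ⊠ B1 ⊠ B1 ⊠ B2 ⊠ B1 ⊠ B2 ⊠ B2 ⊠ B2 ⊠ B1 ⊠ B2) :=
  ((skp (skp (skp (skp (apply4 f))))) :
      B1 ⊠ B2 ⊠ B1 ⊠ B1 ⊠ B1 ⊠ B2 ⊠ B1 ⊠ B2 ⊠ B2 ⊠ B2 ⊠ B1 ⊠ B2 →ₗ[k] B1 ⊠ B2 ⊠ B1 ⊠ B1 ⊠ B1 ⊠ B2 ⊠ B1 ⊠ B2 ⊠ B2 ⊠ B2 ⊠ B1 ⊠ B2)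
    ∘ₗ ((skp (skp swap2)) :
      B1 ⊠ B2 ⊠ B1 ⊠ B1 ⊠ B1 ⊠ B2 ⊠ B1 ⊠ B2 ⊠ B2 ⊠ B2 ⊠ B1 ⊠ B2 →ₗ[k] B1 ⊠ B2 ⊠ B1 ⊠ B1 ⊠ B1 ⊠ B2 ⊠ B1 ⊠ B2 ⊠ B2 ⊠ B2 ⊠ B1 ⊠ B2)
    ∘ₗ ((skp (skp (skp (skp (skp (skp (skp (skp (skp (split2 hd.coactR)))))))))) :
      B1 ⊠ B2 ⊠ B1 ⊠ B1 ⊠ B1 ⊠ B2 ⊠ B1 ⊠ B2 ⊠ B2 ⊠ B2 ⊠ B2 →ₗ[k] B1 ⊠ B2 ⊠ B1 ⊠ B1 ⊠ B1 ⊠ B2 ⊠ B1 ⊠ B2 ⊠ B2 ⊠ B2 ⊠ B1 ⊠ B2)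
    ∘ₗ ((skp (skp (skp (skp (skp (skp (skp (skp (merge2 hd.actR))))))))) :
      B1 ⊠ B2 ⊠ B1 ⊠ B1 ⊠ B1 ⊠ B2 ⊠ B1 ⊠ B2 ⊠ B2 ⊠ B1 ⊠ B2 ⊠ B2 →ₗ[k] B1 ⊠ B2 ⊠ B1 ⊠ B1 ⊠ B1 ⊠ B2 ⊠ B1 ⊠ B2 ⊠ B2 ⊠ B2 ⊠ B2)
    ∘ₗ ((skp (skp (skp (merge2 hd.actL)))) :
      B1 ⊠ B2 ⊠ B1 ⊠ B2 ⊠ B1 ⊠ B1 ⊠ B2 ⊠ B1 ⊠ B2 ⊠ B2 ⊠ B1 ⊠ B2 ⊠ B2 →ₗ[k] B1 ⊠ B2 ⊠ B1 ⊠ B1 ⊠ B1 ⊠ B2 ⊠ B1 ⊠ B2 ⊠ B2 ⊠ B1 ⊠ B2 ⊠ B2)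
    ∘ₗ ((skp (split2 hd.coactL)) :
      B1 ⊠ B1 ⊠ B2 ⊠ B1 ⊠ B1 ⊠ B2 ⊠ B1 ⊠ B2 ⊠ B2 ⊠ B1 ⊠ B2 ⊠ B2 →ₗ[k] B1 ⊠ B2 ⊠ B1 ⊠ B2 ⊠ B1 ⊠ B1 ⊠ B2 ⊠ B1 ⊠ B2 ⊠ B2 ⊠ B1 ⊠ B2 ⊠ B2)
    ∘ₗ ((skp (skp (skp (skp (skp (skp (skp (skp (skp (skp hd.delta2)))))))))) :
      B1 ⊠ B1 ⊠ B2 ⊠ B1 ⊠ B1 ⊠ B2 ⊠ B1 ⊠ B2 ⊠ B2 ⊠ B1 ⊠ B2 →ₗ[k] B1 ⊠ B1 ⊠ B2 ⊠ B1 ⊠ B1 ⊠ B2 ⊠ B1 ⊠ B2 ⊠ B2 ⊠ B1 ⊠ B2 ⊠ B2)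
    ∘ₗ ((skp (skp (skp (skp (skp (skp (skp swap2))))))) :
      B1 ⊠ B1 ⊠ B2 ⊠ B1 ⊠ B1 ⊠ B2 ⊠ B1 ⊠ B2 ⊠ B2 ⊠ B1 ⊠ B2 →ₗ[k] B1 ⊠ B1 ⊠ B2 ⊠ B1 ⊠ B1 ⊠ B2 ⊠ B1 ⊠ B2 ⊠ B2 ⊠ B1 ⊠ B2)
    ∘ₗ ((skp (skp (skp swap2))) :
      B1 ⊠ B1 ⊠ B2 ⊠ B1 ⊠ B1 ⊠ B2 ⊠ B1 ⊠ B2 ⊠ B2 ⊠ B1 ⊠ B2 →ₗ[k] B1 ⊠ B1 ⊠ B2 ⊠ B1 ⊠ B1 ⊠ B2 ⊠ B1 ⊠ B2 ⊠ B2 ⊠ B1 ⊠ B2)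
    ∘ₗ ((split2 hd.delta1) :
      B1 ⊠ B2 ⊠ B1 ⊠ B1 ⊠ B2 ⊠ B1 ⊠ B2 ⊠ B2 ⊠ B1 ⊠ B2 →ₗ[k] B1 ⊠ B1 ⊠ B2 ⊠ B1 ⊠ B1 ⊠ B2 ⊠ B1 ⊠ B2 ⊠ B2 ⊠ B1 ⊠ B2)

/-- Layers 20 to 37: the recombination below `f`. -/
noncomputable def phiD (hd : HopfDatum k B1 B2) :
    (B1 ⊠ B2 ⊠ B1 ⊠ B1 ⊠ B1 ⊠ B2 ⊠ B1 ⊠ B2 ⊠ B2 ⊠ B2 ⊠ B1 ⊠ B2) →ₗ[k]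
    (B1 ⊠ B2 ⊠ B1 ⊠ B2) :=
  ((skp (skp (merge2 hd.m1))) :
      B1 ⊠ B2 ⊠ B1 ⊠ B1 ⊠ B2 →ₗ[k] B1 ⊠ B2 ⊠ B1 ⊠ B2)
    ∘ₗ ((skp (merge2 hd.m2)) :
      B1 ⊠ B2 ⊠ B2 ⊠ B1 ⊠ B1 ⊠ B2 →ₗ[k] B1 ⊠ B2 ⊠ B1 ⊠ B1 ⊠ B2)
    ∘ₗ ((skp (skp (skp (skp (merge2 hd.m1))))) :
      B1 ⊠ B2 ⊠ B2 ⊠ B1 ⊠ B1 ⊠ B1 ⊠ B2 →ₗ[k] B1 ⊠ B2 ⊠ B2 ⊠ B1 ⊠ B1 ⊠ B2)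
    ∘ₗ ((skp (skp swap2)) :
      B1 ⊠ B2 ⊠ B1 ⊠ B2 ⊠ B1 ⊠ B1 ⊠ B2 →ₗ[k] B1 ⊠ B2 ⊠ B2 ⊠ B1 ⊠ B1 ⊠ B1 ⊠ B2)
    ∘ₗ ((skp (merge2 hd.m2)) :
      B1 ⊠ B2 ⊠ B2 ⊠ B1 ⊠ B2 ⊠ B1 ⊠ B1 ⊠ B2 →ₗ[k] B1 ⊠ B2 ⊠ B1 ⊠ B2 ⊠ B1 ⊠ B1 ⊠ B2)
    ∘ₗ ((skp (skp (skp (skp (skp (skp (merge2 hd.actL))))))) :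
      B1 ⊠ B2 ⊠ B2 ⊠ B1 ⊠ B2 ⊠ B1 ⊠ B2 ⊠ B1 ⊠ B2 →ₗ[k] B1 ⊠ B2 ⊠ B2 ⊠ B1 ⊠ B2 ⊠ B1 ⊠ B1 ⊠ B2)
    ∘ₗ ((skp (skp (skp (skp swap2)))) :
      B1 ⊠ B2 ⊠ B2 ⊠ B1 ⊠ B1 ⊠ B2 ⊠ B2 ⊠ B1 ⊠ B2 →ₗ[k] B1 ⊠ B2 ⊠ B2 ⊠ B1 ⊠ B2 ⊠ B1 ⊠ B2 ⊠ B1 ⊠ B2)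
    ∘ₗ ((skp (skp swap2)) :
      B1 ⊠ B2 ⊠ B1 ⊠ B2 ⊠ B1 ⊠ B2 ⊠ B2 ⊠ B1 ⊠ B2 →ₗ[k] B1 ⊠ B2 ⊠ B2 ⊠ B1 ⊠ B1 ⊠ B2 ⊠ B2 ⊠ B1 ⊠ B2)
    ∘ₗ ((skp (merge2 hd.actR)) :
      B1 ⊠ B2 ⊠ B1 ⊠ B1 ⊠ B2 ⊠ B1 ⊠ B2 ⊠ B2 ⊠ B1 ⊠ B2 →ₗ[k] B1 ⊠ B2 ⊠ B1 ⊠ B2 ⊠ B1 ⊠ B2 ⊠ B2 ⊠ B1 ⊠ B2)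
    ∘ₗ ((skp (skp (skp (skp (skp (skp (skp (skp (skp hd.m2))))))))) :
      B1 ⊠ B2 ⊠ B1 ⊠ B1 ⊠ B2 ⊠ B1 ⊠ B2 ⊠ B2 ⊠ B1 ⊠ B2 ⊠ B2 →ₗ[k] B1 ⊠ B2 ⊠ B1 ⊠ B1 ⊠ B2 ⊠ B1 ⊠ B2 ⊠ B2 ⊠ B1 ⊠ B2)
    ∘ₗ ((skp (skp (skp (skp (skp (skp swap2)))))) :
      B1 ⊠ B2 ⊠ B1 ⊠ B1 ⊠ B2 ⊠ B1 ⊠ B2 ⊠ B2 ⊠ B1 ⊠ B2 ⊠ B2 →ₗ[k] B1 ⊠ B2 ⊠ B1 ⊠ B1 ⊠ B2 ⊠ B1 ⊠ B2 ⊠ B2 ⊠ B1 ⊠ B2 ⊠ B2)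
    ∘ₗ ((skp (skp swap2)) :
      B1 ⊠ B2 ⊠ B1 ⊠ B1 ⊠ B2 ⊠ B1 ⊠ B2 ⊠ B2 ⊠ B1 ⊠ B2 ⊠ B2 →ₗ[k] B1 ⊠ B2 ⊠ B1 ⊠ B1 ⊠ B2 ⊠ B1 ⊠ B2 ⊠ B2 ⊠ B1 ⊠ B2 ⊠ B2)
    ∘ₗ ((merge2 hd.m1) :
      B1 ⊠ B1 ⊠ B2 ⊠ B1 ⊠ B1 ⊠ B2 ⊠ B1 ⊠ B2 ⊠ B2 ⊠ B1 ⊠ B2 ⊠ B2 →ₗ[k] B1 ⊠ B2 ⊠ B1 ⊠ B1 ⊠ B2 ⊠ B1 ⊠ B2 ⊠ B2 ⊠ B1 ⊠ B2 ⊠ B2)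
    ∘ₗ ((skp (skp (skp (skp (skp (skp (skp (skp (skp (skp (merge2 hd.actR))))))))))) :
      B1 ⊠ B1 ⊠ B2 ⊠ B1 ⊠ B1 ⊠ B2 ⊠ B1 ⊠ B2 ⊠ B2 ⊠ B1 ⊠ B2 ⊠ B1 ⊠ B2 →ₗ[k] B1 ⊠ B1 ⊠ B2 ⊠ B1 ⊠ B1 ⊠ B2 ⊠ B1 ⊠ B2 ⊠ B2 ⊠ B1 ⊠ B2 ⊠ B2)
    ∘ₗ ((skp (skp (skp (skp (skp (skp (skp (skp (split2 hd.coactR))))))))) :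
      B1 ⊠ B1 ⊠ B2 ⊠ B1 ⊠ B1 ⊠ B2 ⊠ B1 ⊠ B2 ⊠ B2 ⊠ B2 ⊠ B1 ⊠ B2 →ₗ[k] B1 ⊠ B1 ⊠ B2 ⊠ B1 ⊠ B1 ⊠ B2 ⊠ B1 ⊠ B2 ⊠ B2 ⊠ B1 ⊠ B2 ⊠ B1 ⊠ B2)
    ∘ₗ ((skp (skp (split2 hd.coactL))) :
      B1 ⊠ B1 ⊠ B1 ⊠ B1 ⊠ B2 ⊠ B1 ⊠ B2 ⊠ B2 ⊠ B2 ⊠ B1 ⊠ B2 →ₗ[k] B1 ⊠ B1 ⊠ B2 ⊠ B1 ⊠ B1 ⊠ B2 ⊠ B1 ⊠ B2 ⊠ B2 ⊠ B2 ⊠ B1 ⊠ B2)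
    ∘ₗ ((skp (merge2 hd.actL)) :
      B1 ⊠ B2 ⊠ B1 ⊠ B1 ⊠ B1 ⊠ B2 ⊠ B1 ⊠ B2 ⊠ B2 ⊠ B2 ⊠ B1 ⊠ B2 →ₗ[k] B1 ⊠ B1 ⊠ B1 ⊠ B1 ⊠ B2 ⊠ B1 ⊠ B2 ⊠ B2 ⊠ B2 ⊠ B1 ⊠ B2)
    ∘ₗ ((skp (skp (skp (skp (skp (skp (skp (skp swap2)))))))) :
      B1 ⊠ B2 ⊠ B1 ⊠ B1 ⊠ B1 ⊠ B2 ⊠ B1 ⊠ B2 ⊠ B2 ⊠ B2 ⊠ B1 ⊠ B2 →ₗ[k] B1 ⊠ B2 ⊠ B1 ⊠ B1 ⊠ B1 ⊠ B2 ⊠ B1 ⊠ B2 ⊠ B2 ⊠ B2 ⊠ B1 ⊠ B2)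


set_option maxRecDepth 10000 in
/-- Reassembling the blocks gives back the recursion operator, by definitional unfolding of
composition; a deeper recursion limit is necessary owing to the sheer length. -/
theorem Phi_eq (hd : HopfDatum k B1 B2)
    (f : (B1 ⊠ B2 ⊠ B1 ⊠ B2) →ₗ[k] (B1 ⊠ B2 ⊠ B1 ⊠ B2)) :
    Phi hd f = phiD hd ∘ₗ phiC hd f ∘ₗ phiB hd ∘ₗ phiA hd := rfl

variable (hd : HopfDatum k B1 B2)

theorem piMap_tmul (x : B1) (y : B2) (z : B1) (w : B2) :
    piMap hd (x ⊙ y ⊙ z ⊙ w) = (hd.eps1 x * hd.eps2 w) •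
      (hd.eta1 1 ⊙ y ⊙ z ⊙ hd.eta2 1) := by
  show hd.eta1 (hd.eps1 x) ⊙ y ⊙ z ⊙ hd.eta2 (hd.eps2 w) = _
  rw [eta1_r, eta2_r]
  simp only [smul_tl, tmul_smul, smul_smul]
  rw [mul_comm]

/-- the steps after `f`, followed by `π` -/
theorem pi_phiD (X : B1) (Y : B2) (t : B1 ⊠ B2 ⊠ B1 ⊠ B2) :
    piMap hd (phiD hd (hd.eta1 1 ⊙ hd.eta2 1 ⊙ X ⊙ hd.eta1 1 ⊙
      tl4 (Y ⊙ hd.eta2 1 ⊙ hd.eta1 1 ⊙ hd.eta2 1) t)) =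
    (hd.eps1 X * hd.eps2 Y) • piMap hd t := by
  induction t using TensorProduct.induction_on with
  | zero => simp only [map_zero, tmul_zero, smul_zero]
  | add a b ha hb => simp only [map_add, tmul_add, smul_add, ha, hb]
  | tmul x t =>
  induction t using TensorProduct.induction_on with
  | zero => simp only [map_zero, tmul_zero, smul_zero]
  | add a b ha hb => simp only [map_add, tmul_add, smul_add, ha, hb]
  | tmul y t =>
  induction t using TensorProduct.induction_on with
  | zero => simp only [map_zero, tmul_zero, smul_zero]
  | add a b ha hb => simp only [map_add, tmul_add, smul_add, ha, hb]
  | tmul z w =>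
  simp only [smul_tl, tmul_smul, map_smul, tl4_tmul, phiD, LinearMap.comp_apply, skp_tmul, swap2_tmul, split2_tmul,
    merge2_tmul, tl_tmul, coactL_one, coactR_one, actL_one, actR_one, m1_one_left, m2_one_right,
    m2_one_left, m1_one_right, one_actR, one_actL, piMap_tmul, smul_smul]
  congr 1
  ring

/-- the steps around `f`, followed by `π` -/
theorem pi_phiC (f : (B1 ⊠ B2 ⊠ B1 ⊠ B2) →ₗ[k] (B1 ⊠ B2 ⊠ B1 ⊠ B2))
    (b : B2) (c a : B1) (b' : B2) (a' : B1) (b'' d : B2) (e : B1) :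
    piMap hd (phiD hd (phiC hd f (hd.eta1 1 ⊙ b ⊙ c ⊙ a ⊙ b' ⊙
      (a' ⊙ b'' ⊙ d ⊙ e ⊙ hd.eta2 1)))) =
    (hd.eps2 b * hd.eps1 a * (hd.eps2 b'' * hd.eps1 e)) •
      piMap hd (f (c ⊙ b' ⊙ a' ⊙ d)) := by
  simp only [phiC, LinearMap.comp_apply, skp_tmul, swap2_tmul, split2_tmul,
    merge2_tmul, tl_tmul, coactL_one, coactR_one, delta1_one, delta2_one, apply4_tmul]
  rw [pi_phiD, eps1_actL', eps2_actR']

/-- Killing the first leg of the right coaction yields a multiple of the identity. -/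
theorem coactR_eps2' (b : B2) :
    TensorProduct.lid k B1 (TensorProduct.map hd.eps2 LinearMap.id (hd.coactR b)) =
      hd.eps2 b • hd.eta1 1 :=
  (LinearMap.congr_fun hd.coactR_eps2 b).trans (eta1_r hd _)

/-- Symmetrically, discarding the second leg of the left coaction. -/
theorem coactL_eps1' (a : B1) :
    TensorProduct.rid k B2 (TensorProduct.map LinearMap.id hd.eps1 (hd.coactL a)) =
      hd.eps1 a • hd.eta2 1 :=
  (LinearMap.congr_fun hd.coactL_eps1 a).trans (eta2_r hd _)

/-- Collapse both coactions. We replace the coacted elements by arbitrary tensors `s` and `t`, argue by induction on these, and specialise afterwards. -/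
theorem pi_phiB (f : (B1 ⊠ B2 ⊠ B1 ⊠ B2) →ₗ[k] (B1 ⊠ B2 ⊠ B1 ⊠ B2))
    (b b' : B2) (a : B1) (b'' : B2) (a' a'' : B1) :
    piMap hd (phiD hd (phiC hd f (phiB hd (hd.eta1 1 ⊙ b ⊙ b' ⊙ a ⊙
      (b'' ⊙ a' ⊙ a'' ⊙ hd.eta2 1))))) =
    (hd.eps2 b * hd.eps1 a * (hd.eps2 b'' * hd.eps1 a'')) •
      piMap hd (f (hd.eta1 1 ⊙ b' ⊙ a' ⊙ hd.eta2 1)) := by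
  have key : ∀ (s t : B2 ⊠ B1), piMap hd (phiD hd (phiC hd f
      (skp (skp (skp (skp (skp (skp (skp (split2 (LinearMap.toSpanSingleton k _ t))))))))
        (skp (skp (skp (skp (skp swap2)))) (skp (skp (skp swap2))
        (hd.eta1 1 ⊙ tl (b' ⊙ a ⊙
          (b'' ⊙ a' ⊙ (1 : k) ⊙ hd.eta2 1)) s)))))) =
      (hd.eps1 a * hd.eps2 b'') •
      piMap hd (f (TensorProduct.lid k B1 (TensorProduct.map hd.eps2 LinearMap.id s) ⊙
        (b' ⊙ a' ⊙
          TensorProduct.rid k B2 (TensorProduct.map LinearMap.id hd.eps1 t)))) := by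
    intro s t
    induction s using TensorProduct.induction_on with
    | zero => simp only [map_zero, tmul_zero, TensorProduct.zero_tmul, smul_zero]
    | add x y hx hy =>
      simp only [map_add, tmul_add, TensorProduct.add_tmul, smul_add, hx, hy]
    | tmul x y =>
    simp only [tl_tmul, skp_tmul, swap2_tmul, split2_tmul, LinearMap.toSpanSingleton_apply,
      one_smul]
    induction t using TensorProduct.induction_on with
    | zero => simp only [map_zero, tmul_zero, smul_zero]
    | add x y hx hy => simp only [map_add, tmul_add, smul_add, hx, hy]
    | tmul z w =>
    simp only [tl_tmul, pi_phiC, map_tmul, TensorProduct.lid_tmul,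
      TensorProduct.rid_tmul, LinearMap.id_apply, smul_tl, tmul_smul, map_smul,
      smul_smul]
    congr 1
    ring
  have h := key (hd.coactR b) (hd.coactL a'')
  have e : phiB hd (hd.eta1 1 ⊙ b ⊙ b' ⊙ a ⊙
      (b'' ⊙ a' ⊙ a'' ⊙ hd.eta2 1)) =
      (skp (skp (skp (skp (skp (skp (skp (split2
        (LinearMap.toSpanSingleton k _ (hd.coactL a'')))))))))
        (skp (skp (skp (skp (skp swap2)))) (skp (skp (skp swap2))
        (hd.eta1 1 ⊙ tl (b' ⊙ a ⊙
          (b'' ⊙ a' ⊙ (1 : k) ⊙ hd.eta2 1)) (hd.coactR b))))) := by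
    simp only [phiB, LinearMap.comp_apply, skp_tmul, split2_tmul]
    generalize hd.coactR b = s
    induction s using TensorProduct.induction_on with
    | zero => simp only [map_zero, tmul_zero]
    | add x y hx hy => simp only [map_add, tmul_add, hx, hy]
    | tmul x y =>
    simp only [tl_tmul, skp_tmul, swap2_tmul, split2_tmul, LinearMap.toSpanSingleton_apply,
      one_smul]
  rw [e, h, coactR_eps2', coactL_eps1']
  simp only [smul_tl, tmul_smul, map_smul, smul_smul]
  congr 1
  ring

theorem counit_left2 (b : B2) :
    TensorProduct.lid k B2 (TensorProduct.map hd.eps2 LinearMap.id (hd.delta2 b)) = b :=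
  LinearMap.congr_fun hd.coalg2.counit_left b
theorem counit_right2 (b : B2) :
    TensorProduct.rid k B2 (TensorProduct.map LinearMap.id hd.eps2 (hd.delta2 b)) = b :=
  LinearMap.congr_fun hd.coalg2.counit_right b
theorem counit_left1 (b : B1) :
    TensorProduct.lid k B1 (TensorProduct.map hd.eps1 LinearMap.id (hd.delta1 b)) = b :=
  LinearMap.congr_fun hd.coalg1.counit_left b
theorem counit_right1 (b : B1) :
    TensorProduct.rid k B1 (TensorProduct.map LinearMap.id hd.eps1 (hd.delta1 b)) = b :=
  LinearMap.congr_fun hd.coalg1.counit_right b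

/-- a linear functional of a comultiplied strand -/
theorem delta1_elim {N : Type*} [AddCommMonoid N] [Module k N]
    (F : (B1 ⊠ B1) →ₗ[k] N) (G : B1 →ₗ[k] N)
    (h : ∀ x y, F (x ⊙ y) = hd.eps1 y • G x) (a : B1) : F (hd.delta1 a) = G a := by
  have : F = G ∘ₗ (TensorProduct.rid k B1).toLinearMap ∘ₗ
      TensorProduct.map LinearMap.id hd.eps1 := by
    ext x y
    simp [h]
  rw [this]
  exact congrArg G (counit_right1 hd a)

/-- Variant in which the counit hits the other leg. -/
theorem delta1_elim' {N : Type*} [AddCommMonoid N] [Module k N]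
    (F : (B1 ⊠ B1) →ₗ[k] N) (G : B1 →ₗ[k] N)
    (h : ∀ x y, F (x ⊙ y) = hd.eps1 x • G y) (a : B1) : F (hd.delta1 a) = G a := by
  have : F = G ∘ₗ (TensorProduct.lid k B1).toLinearMap ∘ₗ
      TensorProduct.map hd.eps1 LinearMap.id := by
    ext x y
    simp [h]
  rw [this]
  exact congrArg G (counit_left1 hd a)

theorem delta2_elim {N : Type*} [AddCommMonoid N] [Module k N]
    (F : (B2 ⊠ B2) →ₗ[k] N) (G : B2 →ₗ[k] N)
    (h : ∀ x y, F (x ⊙ y) = hd.eps2 y • G x) (a : B2) : F (hd.delta2 a) = G a := by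
  have : F = G ∘ₗ (TensorProduct.rid k B2).toLinearMap ∘ₗ
      TensorProduct.map LinearMap.id hd.eps2 := by
    ext x y
    simp [h]
  rw [this]
  exact congrArg G (counit_right2 hd a)

theorem delta2_elim' {N : Type*} [AddCommMonoid N] [Module k N]
    (F : (B2 ⊠ B2) →ₗ[k] N) (G : B2 →ₗ[k] N)
    (h : ∀ x y, F (x ⊙ y) = hd.eps2 x • G y) (a : B2) : F (hd.delta2 a) = G a := by
  have : F = G ∘ₗ (TensorProduct.lid k B2).toLinearMap ∘ₗ
      TensorProduct.map hd.eps2 LinearMap.id := by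
    ext x y
    simp [h]
  rw [this]
  exact congrArg G (counit_left2 hd a)

set_option maxRecDepth 10000 in
/-- Strip off comultiplications one after another, starting with the latest: each auxiliary
functional `T`, `T4`, `T3`, `T2` absorbs a further layer, while its evaluation on generators loses
precisely one counit factor. -/
theorem pi_phiA (f : (B1 ⊠ B2 ⊠ B1 ⊠ B2) →ₗ[k] (B1 ⊠ B2 ⊠ B1 ⊠ B2))
    (b : B2) (a : B1) :
    piMap hd (phiD hd (phiC hd f (phiB hd (phiA hd (hd.eta1 1 ⊙ b ⊙ a ⊙
      hd.eta2 1))))) =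
      piMap hd (f (hd.eta1 1 ⊙ b ⊙ a ⊙ hd.eta2 1)) := by
  -- the total map and the target map as linear maps
  let T := piMap hd ∘ₗ phiD hd ∘ₗ phiC hd f ∘ₗ phiB hd
  let g2 (a : B1) : B2 →ₗ[k] (B1 ⊠ B2 ⊠ B1 ⊠ B2) :=
    piMap hd ∘ₗ f ∘ₗ mk k _ _ (hd.eta1 1) ∘ₗ
      (mk k _ _).flip (a ⊙ hd.eta2 1)
  let g1 (b : B2) : B1 →ₗ[k] (B1 ⊠ B2 ⊠ B1 ⊠ B2) :=
    piMap hd ∘ₗ f ∘ₗ mk k _ _ (hd.eta1 1) ∘ₗ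
      mk k _ _ b ∘ₗ (mk k _ _).flip (hd.eta2 1)
  have T0 : ∀ b b' a b'' a' a'', T (hd.eta1 1 ⊙ b ⊙ b' ⊙ a ⊙
      (b'' ⊙ a' ⊙ a'' ⊙ hd.eta2 1)) =
      (hd.eps2 b * hd.eps1 a * (hd.eps2 b'' * hd.eps1 a'')) • g1 b' a' :=
    fun b b' a b'' a' a'' => pi_phiB hd f b b' a b'' a' a''
  have T1 : ∀ b b' a b'' a', T (hd.eta1 1 ⊙ b ⊙ b' ⊙ a ⊙
      (b'' ⊙ tl (hd.eta2 1) (hd.delta1 a'))) =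
      (hd.eps2 b * hd.eps1 a * hd.eps2 b'') • g1 b' a' := by
    intro b b' a b'' a'
    refine delta1_elim hd (T ∘ₗ mk k _ _ (hd.eta1 1) ∘ₗ mk k _ _ b ∘ₗ
      mk k _ _ b' ∘ₗ mk k _ _ a ∘ₗ mk k _ _ b'' ∘ₗ
      tl (hd.eta2 1)) ((hd.eps2 b * hd.eps1 a * hd.eps2 b'') • g1 b') ?_ a'
    intro x y
    refine (T0 b b' a b'' x y).trans ?_
    rw [LinearMap.smul_apply, smul_smul]
    congr 1
    ring
  let S5 : (B1 ⊠ B2 ⊠ B2 ⊠ B1 ⊠ B2 ⊠ B1 ⊠ B2) →ₗ[k]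
      (B1 ⊠ B2 ⊠ B2 ⊠ B1 ⊠ B2 ⊠ B1 ⊠ B1 ⊠ B2) :=
    skp (skp (skp (skp (skp (split2 hd.delta1)))))
  let S4 : (B1 ⊠ B2 ⊠ B2 ⊠ B2 ⊠ B1 ⊠ B1 ⊠ B2) →ₗ[k]
      (B1 ⊠ B2 ⊠ B2 ⊠ B1 ⊠ B2 ⊠ B1 ⊠ B2) :=
    skp (skp (skp swap2))
  let S3 : (B1 ⊠ B2 ⊠ B2 ⊠ B1 ⊠ B1 ⊠ B2) →ₗ[k]
      (B1 ⊠ B2 ⊠ B2 ⊠ B2 ⊠ B1 ⊠ B1 ⊠ B2) :=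
    skp (split2 hd.delta2)
  let S2 : (B1 ⊠ B2 ⊠ B2 ⊠ B1 ⊠ B2) →ₗ[k]
      (B1 ⊠ B2 ⊠ B2 ⊠ B1 ⊠ B1 ⊠ B2) :=
    skp (skp (skp (split2 hd.delta1)))
  let T4 := T ∘ₗ S5 ∘ₗ S4
  have T4p : ∀ b b' b'' a a', T4 (hd.eta1 1 ⊙ b ⊙ b' ⊙ b'' ⊙
      (a ⊙ a' ⊙ hd.eta2 1)) =
      (hd.eps2 b * hd.eps1 a * hd.eps2 b'') • g1 b' a' :=
    fun b b' b'' a a' => T1 b b' a b'' a'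
  let T3 := T4 ∘ₗ S3
  have T3p : ∀ b b'' a a', T3 (hd.eta1 1 ⊙ b ⊙ b'' ⊙
      (a ⊙ a' ⊙ hd.eta2 1)) =
      (hd.eps1 a * hd.eps2 b'') • g1 b a' := by
    intro b b'' a a'
    refine delta2_elim' hd (T4 ∘ₗ mk k _ _ (hd.eta1 1) ∘ₗ
      tl (b'' ⊙ a ⊙ a' ⊙ hd.eta2 1)) ((hd.eps1 a * hd.eps2 b'') • g2 a') ?_ b
    intro x y
    refine (T4p x y b'' a a').trans ?_
    rw [LinearMap.smul_apply, smul_smul, ← mul_assoc]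
    rfl
  let T2 := T3 ∘ₗ S2
  have T2p : ∀ b b'' a, T2 (hd.eta1 1 ⊙ b ⊙ b'' ⊙ a ⊙ hd.eta2 1) =
      hd.eps2 b'' • g1 b a := by
    intro b b'' a
    refine delta1_elim' hd (T3 ∘ₗ mk k _ _ (hd.eta1 1) ∘ₗ
      mk k _ _ b ∘ₗ mk k _ _ b'' ∘ₗ tl (hd.eta2 1))
      (hd.eps2 b'' • g1 b) ?_ a
    intro x y
    refine (T3p b b'' x y).trans ?_
    rw [LinearMap.smul_apply, smul_smul]
  refine delta2_elim hd (T2 ∘ₗ mk k _ _ (hd.eta1 1) ∘ₗ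
      tl (a ⊙ hd.eta2 1)) (g2 a) ?_ b
  intro x y
  exact T2p x y a

end Pieces

/-- Lemma 2.12, first part: for every Hopf datum and every endomorphism `f` of
`B₁ ⊗ B₂ ⊗ B₁ ⊗ B₂`, the recursion operator `Φ` satisfies `π ∘ Φ(f) ∘ π = π ∘ f ∘ π`. -/
theorem pi_phi_pi (hd : HopfDatum k B1 B2)
    (f : (B1 ⊗[k] (B2 ⊗[k] (B1 ⊗[k] B2))) →ₗ[k] (B1 ⊗[k] (B2 ⊗[k] (B1 ⊗[k] B2)))) :
    piMap hd ∘ₗ Phi hd f ∘ₗ piMap hd = piMap hd ∘ₗ f ∘ₗ piMap hd := by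
  rw [Phi_eq]
  refine TensorProduct.ext' fun x t => ?_
  induction t using TensorProduct.induction_on with
  | zero => simp only [map_zero, TensorProduct.tmul_zero]
  | add a b ha hb => simp only [map_add, TensorProduct.tmul_add, ha, hb]
  | tmul y t =>
  induction t using TensorProduct.induction_on with
  | zero => simp only [map_zero, TensorProduct.tmul_zero]
  | add a b ha hb => simp only [map_add, TensorProduct.tmul_add, ha, hb]
  | tmul z w =>
  simp only [LinearMap.comp_apply, piMap_tmul, map_smul, pi_phiA]


end CPB
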